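/- Let Φ ∈ ℝ \ ℤ, p > 1, and let V ∈ L^∞(ℝ²) satisfy V(x) = |x|^{−2} (ln|x|)^{−1/p} (1 + o(1)) as |x| → ∞, i.e. |x|² (ln|x|)^{1/p} V(x) → 1 as |x| → ∞. For λ > 0 let N_Φ(λV) ∈ ℕ ∪ {∞} be the supremum of dim M over all finite-dimensional complex subspaces M of C_c^∞(ℝ²\{0}; ℂ) that are (λV)-negative for D_Φ. Then lim_{λ→∞} λ^{−p} N_Φ(λV) = (Γ(p−1/2) / (2√π Γ(p))) · ∑_{n∈ℤ} |n−Φ|^{1−2p}. (Strong-coupling eigenvalue asymptotics for a long-range potential, Aharonov–Bohm case, p > 1.) -/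

import Mathlib

open MeasureTheory

/-- The square of the Euclidean norm on `ℝ²`. -/
noncomputable def sqnorm (x : ℝ × ℝ) : ℝ := x.1 ^ 2 + x.2 ^ 2

/-- Smooth compactly supported functions on `ℝ²` vanishing in a neighbourhood of `0`. -/
def IsTestFun (u : ℝ × ℝ → ℂ) : Prop :=
  ContDiff ℝ (⊤ : ℕ∞) u ∧ HasCompactSupport u ∧ ∀ᶠ x in nhds (0 : ℝ × ℝ), u x = 0

/-- The magnetic energy `∫ |D_Φ u|²` for the Aharonov–Bohm vector potential
`A(x) = |x|⁻² (x₂, -x₁)`, where `D_Φ u = -i∇u + Φ A u`. -/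
noncomputable def magEnergy (Φ : ℝ) (u : ℝ × ℝ → ℂ) : ℝ :=
  ∫ x : ℝ × ℝ,
    (‖-Complex.I * fderiv ℝ u x (1, 0) + ((Φ * (x.2 / sqnorm x) : ℝ) : ℂ) * u x‖ ^ 2 +
     ‖-Complex.I * fderiv ℝ u x (0, 1) + ((Φ * (-x.1 / sqnorm x) : ℝ) : ℂ) * u x‖ ^ 2)

/-- A subspace `M` of test functions is `V`-negative for `D_Φ` if
every nonzero `u ∈ M` satisfies `∫ |D_Φ u|² < ∫ V |u|²`. -/
def IsVNegative (Φ : ℝ) (V : ℝ × ℝ → ℝ) (M : Submodule ℂ (ℝ × ℝ → ℂ)) : Prop :=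
  (∀ u ∈ M, IsTestFun u) ∧
  ∀ u ∈ M, u ≠ 0 → magEnergy Φ u < ∫ x : ℝ × ℝ, V x * ‖u x‖ ^ 2

open scoped ENNReal

/-- The number `N(D_Φ² - W)` of negative eigenvalues, expressed via the variational
principle as the supremum of `dim M` over finite-dimensional `W`-negative subspaces of
test functions. -/
noncomputable def negEigCount (Φ : ℝ) (W : ℝ × ℝ → ℝ) : ℝ≥0∞ :=
  ⨆ (M : Submodule ℂ (ℝ × ℝ → ℂ)) (_ : FiniteDimensional ℂ M ∧ IsVNegative Φ W M),
    (Module.finrank ℂ M : ℝ≥0∞)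

open Real Set

/-- Log-polar coordinates: `(t, θ) ↦ e^t (cos θ, sin θ)`. -/
noncomputable def logPolar (q : ℝ × ℝ) : ℝ × ℝ := (exp q.1 * cos q.2, exp q.1 * sin q.2)

lemma sqnorm_logPolar (q : ℝ × ℝ) : sqnorm (logPolar q) = exp (2 * q.1) := by
  have h := sin_sq_add_cos_sq q.2
  have e : exp (2 * q.1) = exp q.1 ^ 2 := by rw [← exp_nat_mul]; norm_num
  simp only [sqnorm, logPolar]
  rw [e]
  linear_combination exp q.1 ^ 2 * h

lemma contDiff_logPolar : ContDiff ℝ (⊤ : ℕ∞) logPolar := by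
  unfold logPolar
  fun_prop

lemma logPolar_eq_polarCoord_symm (q : ℝ × ℝ) :
    logPolar q = polarCoord.symm (exp q.1, q.2) := rfl

/-- Integration over the plane in log-polar coordinates. -/
lemma integral_eq_integral_logPolar (F : ℝ × ℝ → ℝ) :
    ∫ x, F x = ∫ q in univ ×ˢ Ioo (-π) π, exp (2 * q.1) * F (logPolar q) := by
  rw [← integral_comp_polarCoord_symm]
  have himg : (fun q : ℝ × ℝ => (exp q.1, q.2)) '' (univ ×ˢ Ioo (-π) π) = polarCoord.target := by
    ext ⟨r, s⟩
    simp only [polarCoord_target, mem_image, mem_prod, mem_univ, true_and, Prod.exists,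
      Prod.mk.injEq, mem_Ioi]
    constructor
    · rintro ⟨a, b, hb, rfl, rfl⟩
      exact ⟨exp_pos _, hb⟩
    · rintro ⟨hr, hs⟩
      exact ⟨log r, s, hs, exp_log hr, rfl⟩
  have hderiv : ∀ q : ℝ × ℝ, HasFDerivAt (fun q : ℝ × ℝ => (exp q.1, q.2))
      ((ContinuousLinearMap.prodMap (exp q.1 • ContinuousLinearMap.id ℝ ℝ)
        (ContinuousLinearMap.id ℝ ℝ))) q := by
    intro q
    have h1 : HasFDerivAt (fun q : ℝ × ℝ => exp q.1)
        (exp q.1 • ContinuousLinearMap.fst ℝ ℝ ℝ) q := hasFDerivAt_fst.exp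
    exact (h1.prodMk hasFDerivAt_snd)
  rw [← himg, integral_image_eq_integral_abs_det_fderiv_smul volume
    (MeasurableSet.univ.prod measurableSet_Ioo) (fun q _ => (hderiv q).hasFDerivWithinAt)]
  · congr 1
    ext q
    rw [ContinuousLinearMap.det]
    have : ((ContinuousLinearMap.prodMap (exp q.1 • ContinuousLinearMap.id ℝ ℝ)
        (ContinuousLinearMap.id ℝ ℝ) : (ℝ × ℝ) →L[ℝ] (ℝ × ℝ)) : (ℝ × ℝ) →ₗ[ℝ] (ℝ × ℝ)) =
        LinearMap.prodMap (exp q.1 • LinearMap.id) LinearMap.id := rfl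
    rw [this, LinearMap.det_prodMap]
    simp only [LinearMap.det_smul, Module.finrank_self, pow_one, LinearMap.det_id, mul_one,
      smul_eq_mul, abs_exp]
    rw [logPolar_eq_polarCoord_symm, ← mul_assoc, ← exp_add, two_mul]
  · intro q _ q' _ h
    simp only [Prod.mk.injEq, exp_eq_exp] at h
    exact Prod.ext h.1 h.2

/-- The Euclidean norm square of the magnetic gradient in log-polar coordinates. -/
lemma magnetic_density_logPolar (Φ : ℝ) {u : ℝ × ℝ → ℂ} (hu : Differentiable ℝ u) (q : ℝ × ℝ) :
    exp (2 * q.1) *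
      (‖-Complex.I * fderiv ℝ u (logPolar q) (1, 0) +
          ((Φ * ((logPolar q).2 / sqnorm (logPolar q)) : ℝ) : ℂ) * u (logPolar q)‖ ^ 2 +
       ‖-Complex.I * fderiv ℝ u (logPolar q) (0, 1) +
          ((Φ * (-(logPolar q).1 / sqnorm (logPolar q)) : ℝ) : ℂ) * u (logPolar q)‖ ^ 2) =
    ‖fderiv ℝ (u ∘ logPolar) q (1, 0)‖ ^ 2 +
      ‖-Complex.I * fderiv ℝ (u ∘ logPolar) q (0, 1) - Φ * u (logPolar q)‖ ^ 2 := by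
  have hP : HasFDerivAt logPolar
      (((exp q.1 * cos q.2) • ContinuousLinearMap.fst ℝ ℝ ℝ +
          (-(exp q.1 * sin q.2)) • ContinuousLinearMap.snd ℝ ℝ ℝ).prod
        ((exp q.1 * sin q.2) • ContinuousLinearMap.fst ℝ ℝ ℝ +
          (exp q.1 * cos q.2) • ContinuousLinearMap.snd ℝ ℝ ℝ)) q := by
    have h1 : HasFDerivAt (fun q : ℝ × ℝ => exp q.1)
        (exp q.1 • ContinuousLinearMap.fst ℝ ℝ ℝ) q := hasFDerivAt_fst.exp
    have h2 : HasFDerivAt (fun q : ℝ × ℝ => cos q.2)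
        (-sin q.2 • ContinuousLinearMap.snd ℝ ℝ ℝ) q := hasFDerivAt_snd.cos
    have h3 : HasFDerivAt (fun q : ℝ × ℝ => sin q.2)
        (cos q.2 • ContinuousLinearMap.snd ℝ ℝ ℝ) q := hasFDerivAt_snd.sin
    refine HasFDerivAt.prodMk ((h1.mul h2).congr_fderiv ?_) ((h1.mul h3).congr_fderiv ?_)
    · ext <;> simp [mul_comm]
    · ext <;> simp [mul_comm]
  have hc := (hu (logPolar q)).hasFDerivAt.comp q hP
  rw [hc.fderiv, sqnorm_logPolar]
  set D := fderiv ℝ u (logPolar q)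
  have hD : ∀ a b : ℝ, D (a, b) = a * D (1, 0) + b * D (0, 1) := by
    intro a b
    have : ((a, b) : ℝ × ℝ) = a • (1, 0) + b • (0, 1) := by simp
    rw [this, map_add, map_smul, map_smul]
    simp
  simp only [ContinuousLinearMap.comp_apply, ContinuousLinearMap.prod_apply,
    add_apply, smul_apply,
    ContinuousLinearMap.coe_fst', ContinuousLinearMap.coe_snd', smul_eq_mul, mul_one, mul_zero,
    add_zero, zero_add]
  rw [hD (exp q.1 * cos q.2), hD (-(exp q.1 * sin q.2))]
  have e : exp (2 * q.1) = exp q.1 ^ 2 := by rw [← exp_nat_mul]; norm_num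
  have hs := sin_sq_add_cos_sq q.2
  simp only [logPolar] at *
  set c := cos q.2
  set s := sin q.2
  set r := exp q.1 with hr
  have hr0 : r ≠ 0 := (exp_pos _).ne'
  have hA : r * (Φ * (r * s / r ^ 2)) = Φ * s := by field_simp
  have hB : r * (Φ * (-(r * c) / r ^ 2)) = -(Φ * c) := by field_simp
  rw [e]
  set A := Φ * (r * s / r ^ 2)
  set B := Φ * (-(r * c) / r ^ 2)
  clear_value A B
  simp only [← Complex.normSq_eq_norm_sq, Complex.normSq_apply]
  simp only [neg_mul, Complex.add_re, Complex.neg_re, Complex.mul_re, Complex.I_re, zero_mul,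
    Complex.I_im, one_mul, zero_sub, neg_neg, Complex.ofReal_re, Complex.ofReal_im, sub_zero,
    Complex.add_im, Complex.neg_im, Complex.mul_im, zero_add, add_zero, Complex.sub_re,
    Complex.sub_im, Complex.ofReal_mul, Complex.ofReal_neg]
  generalize (D (1,0)).re = a
  generalize (D (1,0)).im = a'
  generalize (D (0,1)).re = b
  generalize (D (0,1)).im = b'
  generalize (u (r * c, r * s)).re = v
  generalize (u (r * c, r * s)).im = v'
  have hc2 : c ^ 2 = 1 - s ^ 2 := by linarith
  have e1 : r ^ 2 * ((a' + A * v) * (a' + A * v) + (-a + A * v') * (-a + A * v') +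
      ((b' + B * v) * (b' + B * v) + (-b + B * v') * (-b + B * v'))) =
      (r * a' + (r * A) * v) ^ 2 + (-(r * a) + (r * A) * v') ^ 2 +
      ((r * b' + (r * B) * v) ^ 2 + (-(r * b) + (r * B) * v') ^ 2) := by ring
  rw [e1, hA, hB]
  ring_nf
  simp only [hc2]
  ring

lemma IsTestFun.differentiable {u : ℝ × ℝ → ℂ} (hu : IsTestFun u) : Differentiable ℝ u :=
  hu.1.differentiable (by simp)

lemma IsTestFun.contDiff_comp_logPolar {u : ℝ × ℝ → ℂ} (hu : IsTestFun u) :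
    ContDiff ℝ (⊤ : ℕ∞) (u ∘ logPolar) := hu.1.comp contDiff_logPolar

lemma IsTestFun.exists_radius {u : ℝ × ℝ → ℂ} (hu : IsTestFun u) :
    ∃ R : ℝ, 0 < R ∧ ∀ q : ℝ × ℝ, R ≤ |q.1| → (u ∘ logPolar) q = 0 := by
  obtain ⟨-, hc, h0⟩ := hu
  obtain ⟨r, hr, hr0⟩ := Metric.eventually_nhds_iff.1 h0
  obtain ⟨C, hC⟩ := hc.isCompact.isBounded.exists_norm_le
  refine ⟨max 1 (max (1 - log r) (1 + log (2 * (|C| + 1)))), by positivity, fun q hq => ?_⟩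
  have h2 := (le_max_left _ _).trans ((le_max_right _ _).trans hq)
  have h3 := (le_max_right _ _).trans ((le_max_right _ _).trans hq)
  have h1 := (le_max_left _ _).trans hq
  rcases le_or_gt 0 q.1 with h | h
  · rw [abs_of_nonneg h] at h3
    by_contra hne
    have hmem := hC _ (subset_tsupport u hne)
    have hexp : 2 * (|C| + 1) ≤ exp q.1 := by
      rw [← log_le_iff_le_exp (by positivity)]; linarith
    have hx : ‖(logPolar q).1‖ ≤ |C| := (norm_fst_le _).trans (hmem.trans (le_abs_self C))
    have hy : ‖(logPolar q).2‖ ≤ |C| := (norm_snd_le _).trans (hmem.trans (le_abs_self C))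
    have hs := sqnorm_logPolar q
    have e : exp (2 * q.1) = exp q.1 ^ 2 := by rw [← exp_nat_mul]; norm_num
    rw [e, sqnorm, ← sq_abs (logPolar q).1, ← sq_abs (logPolar q).2] at hs
    have hx2 : |(logPolar q).1| ^ 2 ≤ |C| ^ 2 := pow_le_pow_left₀ (abs_nonneg _) hx 2
    have hy2 : |(logPolar q).2| ^ 2 ≤ |C| ^ 2 := pow_le_pow_left₀ (abs_nonneg _) hy 2
    nlinarith [abs_nonneg C]
  · rw [abs_of_neg h] at h2
    apply hr0
    have hexp : exp q.1 < r := by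
      rw [← lt_log_iff_exp_lt hr]; linarith
    rw [dist_zero_right, Prod.norm_def]
    refine max_lt ?_ ?_
    · simp only [logPolar, norm_eq_abs, abs_mul, abs_exp]
      nlinarith [abs_cos_le_one q.2, exp_pos q.1]
    · simp only [logPolar, norm_eq_abs, abs_mul, abs_exp]
      nlinarith [abs_sin_le_one q.2, exp_pos q.1]

lemma fderiv_eq_zero_of_abs_fst_gt {U : ℝ × ℝ → ℂ} {R : ℝ}
    (h : ∀ q : ℝ × ℝ, R ≤ |q.1| → U q = 0) (q : ℝ × ℝ) (hq : R < |q.1|) :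
    fderiv ℝ U q = 0 := by
  have : U =ᶠ[nhds q] fun _ => 0 := by
    have ho : IsOpen {q : ℝ × ℝ | R < |q.1|} := isOpen_lt continuous_const (by fun_prop)
    filter_upwards [ho.mem_nhds hq] with x hx using h x (le_of_lt hx)
  rw [this.fderiv_eq]
  simp

/-- Functions on the cylinder that vanish for large `|t|` may be integrated iteratedly. -/
lemma integral_cylinder {G : ℝ × ℝ → ℝ} (hG : Continuous G) {R B : ℝ}
    (hR : ∀ q : ℝ × ℝ, R < |q.1| → G q = 0) {ω : ℝ → ℝ} (hω : Measurable ω)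
    (hB : ∀ t, |t| ≤ R → |ω t| ≤ B) :
    ∫ q in univ ×ˢ Ioo (-π) π, ω q.1 * G q = ∫ t, ω t * ∫ θ in (-π)..π, G (t, θ) := by
  have hint : IntegrableOn (fun q : ℝ × ℝ => ω q.1 * G q) (univ ×ˢ Ioo (-π) π) := by
    have h1 : IntegrableOn (fun q : ℝ × ℝ => ω q.1 * G q) (Icc (-R) R ×ˢ Ioo (-π) π) := by
      have h2 : IntegrableOn G (Icc (-R) R ×ˢ Ioo (-π) π) :=
        (hG.continuousOn.integrableOn_compact (isCompact_Icc.prod isCompact_Icc)).mono_set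
          (prod_mono_right Ioo_subset_Icc_self)
      refine h2.bdd_mul (c := B) (hω.comp measurable_fst).aestronglyMeasurable ?_
      refine (ae_restrict_iff' (measurableSet_Icc.prod measurableSet_Ioo)).2 (ae_of_all _ ?_)
      intro q hq
      exact hB _ (abs_le.2 hq.1)
    refine h1.of_forall_sdiff_eq_zero (MeasurableSet.univ.prod measurableSet_Ioo) ?_
    intro q hq
    rw [hR q, mul_zero]
    by_contra hcon
    exact hq.2 ⟨abs_le.1 (not_lt.1 hcon), hq.1.2⟩
  rw [Measure.volume_eq_prod] at hint ⊢
  rw [setIntegral_prod _ hint, setIntegral_univ]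
  congr 1
  ext t
  rw [intervalIntegral.integral_of_le (by linarith [pi_pos]), ← integral_Ioc_eq_integral_Ioo]
  exact MeasureTheory.integral_const_mul (ω t) fun θ => G (t, θ)

/-- The density of the magnetic energy in log-polar coordinates. -/
noncomputable def cylinderDensity (Φ : ℝ) (U : ℝ × ℝ → ℂ) (q : ℝ × ℝ) : ℝ :=
  ‖fderiv ℝ U q (1, 0)‖ ^ 2 + ‖-Complex.I * fderiv ℝ U q (0, 1) - Φ * U q‖ ^ 2

lemma continuous_fderiv_apply {U : ℝ × ℝ → ℂ} (hU : ContDiff ℝ (⊤ : ℕ∞) U) (v : ℝ × ℝ) :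
    Continuous fun q => fderiv ℝ U q v :=
  (hU.continuous_fderiv (by simp)).clm_apply continuous_const

lemma continuous_cylinderDensity (Φ : ℝ) {U : ℝ × ℝ → ℂ} (hU : ContDiff ℝ (⊤ : ℕ∞) U) :
    Continuous (cylinderDensity Φ U) := by
  have h1 := continuous_fderiv_apply hU (1, 0)
  have h2 := continuous_fderiv_apply hU (0, 1)
  have h3 := hU.continuous
  unfold cylinderDensity
  fun_prop

lemma cylinderDensity_eq_zero (Φ : ℝ) {U : ℝ × ℝ → ℂ} {R : ℝ}
    (h : ∀ q : ℝ × ℝ, R ≤ |q.1| → U q = 0) (q : ℝ × ℝ) (hq : R < |q.1|) :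
    cylinderDensity Φ U q = 0 := by
  simp [cylinderDensity, fderiv_eq_zero_of_abs_fst_gt h q hq, h q hq.le]

lemma magEnergy_eq_integral_cylinder (Φ : ℝ) {u : ℝ × ℝ → ℂ} (hu : IsTestFun u) :
    magEnergy Φ u = ∫ t, ∫ θ in (-π)..π, cylinderDensity Φ (u ∘ logPolar) (t, θ) := by
  obtain ⟨R, -, hR⟩ := hu.exists_radius
  have h := integral_cylinder (continuous_cylinderDensity Φ hu.contDiff_comp_logPolar)
    (cylinderDensity_eq_zero Φ hR) (ω := fun _ => 1) (B := 1) measurable_const (by simp)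
  simp only [one_mul] at h
  rw [← h, magEnergy, integral_eq_integral_logPolar]
  congr 1
  ext q
  exact magnetic_density_logPolar Φ hu.differentiable q

/-- The radial potential on the plane which becomes `ω` in log-polar coordinates. -/
noncomputable def radialPotential (ω : ℝ → ℝ) (x : ℝ × ℝ) : ℝ :=
  ω (log (sqnorm x) / 2) / sqnorm x

lemma radialPotential_logPolar (ω : ℝ → ℝ) (q : ℝ × ℝ) :
    exp (2 * q.1) * radialPotential ω (logPolar q) = ω q.1 := by
  rw [radialPotential, sqnorm_logPolar, log_exp]
  field_simp

lemma integral_radialPotential {u : ℝ × ℝ → ℂ} (hu : IsTestFun u) {ω : ℝ → ℝ}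
    (hω : Measurable ω) (hB : ∀ R, ∃ B, ∀ t, |t| ≤ R → |ω t| ≤ B) :
    ∫ x, radialPotential ω x * ‖u x‖ ^ 2 =
      ∫ t, ω t * ∫ θ in (-π)..π, ‖(u ∘ logPolar) (t, θ)‖ ^ 2 := by
  obtain ⟨R, -, hR⟩ := hu.exists_radius
  obtain ⟨B, hB⟩ := hB R
  rw [← integral_cylinder (G := fun q => ‖(u ∘ logPolar) q‖ ^ 2) (R := R) (B := B)
    (hu.contDiff_comp_logPolar.continuous.norm.pow 2)
    (fun q hq => by simp only [hR q hq.le]; simp) hω hB, integral_eq_integral_logPolar]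
  congr 1
  ext q
  rw [← mul_assoc, radialPotential_logPolar]
  rfl

lemma continuous_sqnorm : Continuous sqnorm := by unfold sqnorm; fun_prop

/-- A potential bounded in absolute value on the complement of a neighbourhood of `0` is
integrable against the density of a test function. -/
lemma integrable_mul_norm_sq {u : ℝ × ℝ → ℂ} (hu : IsTestFun u) {W : ℝ × ℝ → ℝ}
    (hW : Measurable W) {B : ℝ} (hB : ∀ᵐ x, u x ≠ 0 → |W x| ≤ B) :
    Integrable fun x => W x * ‖u x‖ ^ 2 := by
  have h1 : Integrable fun x => ‖u x‖ ^ 2 :=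
    (by have := hu.1.continuous; fun_prop : Continuous fun x => ‖u x‖ ^ 2).integrable_of_hasCompactSupport
      (by
        have := hu.2.1.comp_left (g := fun z : ℂ => ‖z‖ ^ 2) (by simp)
        exact this)
  refine (h1.const_mul B).mono' (by
    have := hu.1.continuous.measurable
    exact (hW.mul (this.norm.pow_const 2)).aestronglyMeasurable) ?_
  filter_upwards [hB] with x hx
  rw [norm_mul, norm_eq_abs, norm_of_nonneg (sq_nonneg ‖u x‖)]
  by_cases h : u x = 0
  · simp [h]
  · exact mul_le_mul_of_nonneg_right (hx h) (sq_nonneg _)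

lemma exists_logPolar_eq {x : ℝ × ℝ} (hx : x ≠ 0) : ∃ q, logPolar q = x := by
  set z : ℂ := ⟨x.1, x.2⟩ with hz
  have hz0 : z ≠ 0 := by
    intro h
    rw [Complex.ext_iff] at h
    exact hx (Prod.ext h.1 h.2)
  refine ⟨(log ‖z‖, z.arg), ?_⟩
  simp only [logPolar, exp_log (norm_pos_iff.2 hz0), Complex.norm_mul_cos_arg,
    Complex.norm_mul_sin_arg]
  rfl

lemma IsTestFun.ne_zero_of_apply_ne_zero {u : ℝ × ℝ → ℂ} (hu : IsTestFun u) {x : ℝ × ℝ}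
    (hx : u x ≠ 0) : x ≠ 0 := by
  rintro rfl
  exact hx hu.2.2.self_of_nhds

lemma measurable_radialPotential {ω : ℝ → ℝ} (hω : Measurable ω) :
    Measurable (radialPotential ω) := by
  have := continuous_sqnorm.measurable
  unfold radialPotential
  fun_prop

lemma integrable_radialPotential {u : ℝ × ℝ → ℂ} (hu : IsTestFun u) {ω : ℝ → ℝ}
    (hω : Measurable ω) (hB : ∀ R, ∃ B, ∀ t, |t| ≤ R → |ω t| ≤ B) :
    Integrable fun x => radialPotential ω x * ‖u x‖ ^ 2 := by
  obtain ⟨R, -, hR⟩ := hu.exists_radius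
  obtain ⟨B, hB⟩ := hB R
  refine integrable_mul_norm_sq hu (measurable_radialPotential hω) (B := B * exp (2 * R))
    (ae_of_all _ fun x hx => ?_)
  obtain ⟨q, rfl⟩ := exists_logPolar_eq (hu.ne_zero_of_apply_ne_zero hx)
  have hq : |q.1| < R := by
    by_contra hcon
    exact hx (hR q (not_lt.1 hcon))
  have h1 := hB q.1 hq.le
  rw [radialPotential, sqnorm_logPolar, log_exp, mul_div_cancel_left₀ _ two_ne_zero, abs_div,
    abs_exp, div_le_iff₀ (exp_pos _), mul_assoc, ← exp_add]
  have h2 : 1 ≤ exp (2 * R + 2 * q.1) := one_le_exp (by linarith [(abs_lt.1 hq).1])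
  nlinarith [abs_nonneg (ω q.1)]

/-- The (unnormalised) `n`-th angular Fourier coefficient. -/
noncomputable def angCoeff (n : ℤ) (g : ℝ → ℂ) : ℂ :=
  ∫ θ in (-π)..π, Complex.exp (-(n * θ * Complex.I)) * g θ

lemma neg_pi_lt_pi : -π < π := by linarith [pi_pos]

lemma fourierCoeffOn_eq_angCoeff (n : ℤ) (g : ℝ → ℂ) :
    fourierCoeffOn neg_pi_lt_pi g n = (1 / (2 * π)) • angCoeff n g := by
  rw [fourierCoeffOn_eq_integral, angCoeff, show π - -π = 2 * π by ring]
  congr 1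
  refine intervalIntegral.integral_congr fun θ _ => ?_
  simp only [smul_eq_mul]
  rw [fourier_coe_apply]
  congr 2
  have : (π : ℂ) ≠ 0 := by exact_mod_cast pi_ne_zero
  push_cast
  field_simp

lemma hasSum_norm_sq_angCoeff {g : ℝ → ℂ} (hg : Continuous g) :
    HasSum (fun n => ‖angCoeff n g‖ ^ 2) (2 * π * ∫ θ in (-π)..π, ‖g θ‖ ^ 2) := by
  have hL : MemLp g 2 (volume.restrict (Ioc (-π) π)) := by
    obtain ⟨C, hC⟩ := (isCompact_Icc (a := -π) (b := π)).exists_bound_of_continuousOn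
      hg.continuousOn
    refine MemLp.of_bound hg.aestronglyMeasurable C ?_
    exact (ae_restrict_iff' measurableSet_Ioc).2
      (ae_of_all _ fun θ hθ => hC θ (Ioc_subset_Icc_self hθ))
  have h := (hasSum_sq_fourierCoeffOn neg_pi_lt_pi hL).mul_left ((2 * π) ^ 2)
  have hpi := pi_pos
  have e1 : (fun n => ‖angCoeff n g‖ ^ 2) =
      fun n => (2 * π) ^ 2 * ‖fourierCoeffOn neg_pi_lt_pi g n‖ ^ 2 := by
    funext n
    rw [fourierCoeffOn_eq_angCoeff, norm_smul, norm_eq_abs, abs_of_pos (by positivity)]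
    field_simp
  have e2 : 2 * π * ∫ θ in (-π)..π, ‖g θ‖ ^ 2 =
      (2 * π) ^ 2 * (π - -π)⁻¹ • ∫ θ in (-π)..π, ‖g θ‖ ^ 2 := by
    rw [smul_eq_mul, show π - -π = 2 * π by ring]
    field_simp
  rw [e1, e2]
  exact h

lemma angCoeff_deriv (n : ℤ) {g g' : ℝ → ℂ} (hg : ∀ θ, HasDerivAt g (g' θ) θ)
    (hg' : Continuous g') (hper : g (-π) = g π) :
    angCoeff n g' = n * Complex.I * angCoeff n g := by
  have hgc : Continuous g := continuous_iff_continuousAt.2 fun θ => (hg θ).continuousAt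
  have he : ∀ θ : ℝ, HasDerivAt (fun θ : ℝ => Complex.exp (-(n * θ * Complex.I)))
      (Complex.exp (-(n * θ * Complex.I)) * (-(n * Complex.I))) θ := by
    intro θ
    have h1 : HasDerivAt (fun θ : ℝ => (-(n * (θ : ℂ) * Complex.I))) (-(n * Complex.I)) θ := by
      have := ((Complex.ofRealCLM.hasDerivAt (x := θ)).const_mul (n : ℂ)).mul_const Complex.I
      have h2 := this.neg
      simp only [Complex.ofRealCLM_apply, Complex.ofReal_one, mul_one] at h2
      exact h2
    exact h1.cexp
  have hd : ∀ θ : ℝ, HasDerivAt (fun θ : ℝ => Complex.exp (-(n * θ * Complex.I)) * g θ)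
      (Complex.exp (-(n * θ * Complex.I)) * g' θ -
        n * Complex.I * (Complex.exp (-(n * θ * Complex.I)) * g θ)) θ := by
    intro θ
    refine ((he θ).mul (hg θ)).congr_deriv ?_
    ring
  have hint : ∀ k : ℝ → ℂ, Continuous k →
      IntervalIntegrable (fun θ : ℝ => Complex.exp (-(n * θ * Complex.I)) * k θ) volume (-π) π :=
    fun k hk => (by fun_prop : Continuous _).intervalIntegrable _ _
  have h := intervalIntegral.integral_eq_sub_of_hasDerivAt (fun θ _ => hd θ)
    ((hint _ hg').sub ((hint _ hgc).const_mul _))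
  rw [intervalIntegral.integral_sub (hint _ hg') ((hint _ hgc).const_mul _),
    intervalIntegral.integral_const_mul] at h
  have hend : Complex.exp (-(n * ((π : ℝ) : ℂ) * Complex.I)) =
      Complex.exp (-(n * ((-π : ℝ) : ℂ) * Complex.I)) := by
    rw [Complex.exp_eq_exp_iff_exists_int]
    exact ⟨-n, by push_cast; ring⟩
  rw [hend, hper, sub_self, sub_eq_zero] at h
  exact h

lemma angCoeff_sub_const_mul (n : ℤ) {g h : ℝ → ℂ} (hg : Continuous g) (hh : Continuous h)
    (a b : ℂ) :
    angCoeff n (fun θ => a * g θ - b * h θ) = a * angCoeff n g - b * angCoeff n h := by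
  have hint : ∀ k : ℝ → ℂ, Continuous k →
      IntervalIntegrable (fun θ : ℝ => Complex.exp (-(n * θ * Complex.I)) * k θ) volume (-π) π :=
    fun k hk => (by fun_prop : Continuous _).intervalIntegrable _ _
  unfold angCoeff
  rw [← intervalIntegral.integral_const_mul, ← intervalIntegral.integral_const_mul,
    ← intervalIntegral.integral_sub ((hint _ hg).const_mul _) ((hint _ hh).const_mul _)]
  congr 1
  ext θ
  ring

lemma angCoeff_magnetic (Φ : ℝ) (n : ℤ) {g g' : ℝ → ℂ} (hg : ∀ θ, HasDerivAt g (g' θ) θ)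
    (hg' : Continuous g') (hper : g (-π) = g π) :
    angCoeff n (fun θ => -Complex.I * g' θ - Φ * g θ) = ((n - Φ : ℝ) : ℂ) * angCoeff n g := by
  have hgc : Continuous g := continuous_iff_continuousAt.2 fun θ => (hg θ).continuousAt
  rw [angCoeff_sub_const_mul n hg' hgc, angCoeff_deriv n hg hg' hper]
  push_cast
  linear_combination (-(n : ℂ) * angCoeff n g) * Complex.I_sq

/-- On each circle, the form is bounded below by its restriction to finitely many angular
momenta, as soon as these comprise all momenta with negative angular energy. -/
lemma sum_angCoeff_le (Φ Λ : ℝ) {g g' h : ℝ → ℂ} (hg : ∀ θ, HasDerivAt g (g' θ) θ)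
    (hg' : Continuous g') (hper : g (-π) = g π) (hh : Continuous h) (F : Finset ℤ)
    (hF : ∀ n : ℤ, n ∉ F → Λ ≤ (n - Φ) ^ 2) :
    ∑ n ∈ F, (‖angCoeff n h‖ ^ 2 + ((n - Φ) ^ 2 - Λ) * ‖angCoeff n g‖ ^ 2) ≤
      2 * π * ((∫ θ in (-π)..π, (‖h θ‖ ^ 2 + ‖-Complex.I * g' θ - Φ * g θ‖ ^ 2)) -
        Λ * ∫ θ in (-π)..π, ‖g θ‖ ^ 2) := by
  have hgc : Continuous g := continuous_iff_continuousAt.2 fun θ => (hg θ).continuousAt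
  have hm : Continuous fun θ => -Complex.I * g' θ - Φ * g θ := by fun_prop
  have hsum := ((hasSum_norm_sq_angCoeff hh).add (hasSum_norm_sq_angCoeff hm)).sub
    ((hasSum_norm_sq_angCoeff hgc).mul_left Λ)
  have hadd := intervalIntegral.integral_add (μ := volume) (a := -π) (b := π)
    (f := fun θ => ‖h θ‖ ^ 2) (g := fun θ => ‖-Complex.I * g' θ - Φ * g θ‖ ^ 2)
    ((hh.norm.pow 2).intervalIntegrable _ _) ((hm.norm.pow 2).intervalIntegrable _ _)
  rw [hadd]
  have hterm : ∀ n : ℤ, ‖angCoeff n h‖ ^ 2 +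
      ‖angCoeff n (fun θ => -Complex.I * g' θ - Φ * g θ)‖ ^ 2 - Λ * ‖angCoeff n g‖ ^ 2 =
      ‖angCoeff n h‖ ^ 2 + ((n - Φ) ^ 2 - Λ) * ‖angCoeff n g‖ ^ 2 := by
    intro n
    rw [angCoeff_magnetic Φ n hg hg' hper, norm_mul, Complex.norm_real, mul_pow, norm_eq_abs,
      sq_abs]
    ring
  simp only [hterm] at hsum
  have := sum_le_hasSum F (fun n hn => by
    have := hF n hn
    have h1 : 0 ≤ ((n - Φ) ^ 2 - Λ) * ‖angCoeff n g‖ ^ 2 :=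
      mul_nonneg (by linarith) (sq_nonneg _)
    positivity) hsum
  linarith

lemma hasDerivAt_fst_slice {U : ℝ × ℝ → ℂ} (hU : ContDiff ℝ (⊤ : ℕ∞) U) (t θ : ℝ) :
    HasDerivAt (fun t => U (t, θ)) (fderiv ℝ U (t, θ) (1, 0)) t := by
  have h1 := (hU.differentiable (by simp) (t, θ)).hasFDerivAt
  exact h1.comp_hasDerivAt t ((hasDerivAt_id t).prodMk (hasDerivAt_const t θ))

lemma hasDerivAt_snd_slice {U : ℝ × ℝ → ℂ} (hU : ContDiff ℝ (⊤ : ℕ∞) U) (t θ : ℝ) :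
    HasDerivAt (fun θ => U (t, θ)) (fderiv ℝ U (t, θ) (0, 1)) θ := by
  have h1 := (hU.differentiable (by simp) (t, θ)).hasFDerivAt
  exact h1.comp_hasDerivAt θ ((hasDerivAt_const θ t).prodMk (hasDerivAt_id θ))

lemma continuous_angCoeff (n : ℤ) {G : ℝ × ℝ → ℂ} (hG : Continuous G) :
    Continuous fun t => angCoeff n fun θ => G (t, θ) := by
  unfold angCoeff
  apply intervalIntegral.continuous_parametric_intervalIntegral_of_continuous'
  simp only [Function.uncurry_def]
  fun_prop

lemma hasDerivAt_angCoeff (n : ℤ) {U : ℝ × ℝ → ℂ} (hU : ContDiff ℝ (⊤ : ℕ∞) U) (t : ℝ) :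
    HasDerivAt (fun t => angCoeff n fun θ => U (t, θ))
      (angCoeff n fun θ => fderiv ℝ U (t, θ) (1, 0)) t := by
  have hc := continuous_fderiv_apply hU (1, 0)
  have hUc := hU.continuous
  obtain ⟨C, hC⟩ := ((isCompact_Icc (a := t - 1) (b := t + 1)).prod
    (isCompact_Icc (a := -π) (b := π))).exists_bound_of_continuousOn hc.continuousOn
  refine (intervalIntegral.hasDerivAt_integral_of_dominated_loc_of_deriv_le
    (F := fun t θ => Complex.exp (-(n * θ * Complex.I)) * U (t, θ))
    (F' := fun t θ => Complex.exp (-(n * θ * Complex.I)) * fderiv ℝ U (t, θ) (1, 0))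
    (bound := fun _ => C) (Metric.ball_mem_nhds t one_pos) ?_ ?_ ?_ ?_ ?_ ?_).2
  · exact Filter.Eventually.of_forall fun s =>
      (by fun_prop : Continuous fun θ : ℝ => Complex.exp (-(n * θ * Complex.I)) * U (s, θ)).aestronglyMeasurable
  · exact (by fun_prop : Continuous fun θ : ℝ =>
      Complex.exp (-(n * θ * Complex.I)) * U (t, θ)).intervalIntegrable _ _
  · exact (by fun_prop : Continuous fun θ : ℝ =>
      Complex.exp (-(n * θ * Complex.I)) * fderiv ℝ U (t, θ) (1, 0)).aestronglyMeasurable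
  · refine ae_of_all _ fun θ hθ s hs => ?_
    rw [uIoc_of_le neg_pi_lt_pi.le] at hθ
    rw [Metric.mem_ball, dist_eq, abs_lt] at hs
    have h1 : ‖Complex.exp (-(n * θ * Complex.I))‖ = 1 := by
      rw [show (-(n * θ * Complex.I) : ℂ) = ((-(n * θ) : ℝ) : ℂ) * Complex.I by push_cast; ring]
      exact Complex.norm_exp_ofReal_mul_I _
    rw [norm_mul, h1, one_mul]
    exact hC (s, θ) ⟨⟨by linarith, by linarith⟩, ⟨hθ.1.le, hθ.2⟩⟩
  · exact intervalIntegrable_const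
  · refine ae_of_all _ fun θ _ s _ => ?_
    exact (hasDerivAt_fst_slice hU s θ).const_mul _

/-- Wirtinger's inequality with Dirichlet conditions, on an interval shorter than `π / κ`. -/
lemma wirtinger_dirichlet {a b κ : ℝ} (hab : a ≤ b) (hκ : 0 ≤ κ) (hlen : κ * (b - a) < π)
    {v v' : ℝ → ℂ} (hv : ∀ t, HasDerivAt v (v' t) t) (hv' : Continuous v')
    (ha : v a = 0) (hb : v b = 0) :
    κ ^ 2 * ∫ t in a..b, ‖v t‖ ^ 2 ≤ ∫ t in a..b, ‖v' t‖ ^ 2 := by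
  have hvc : Continuous v := continuous_iff_continuousAt.2 fun t => (hv t).continuousAt
  set m := (a + b) / 2 with hm
  have hcos : ∀ t ∈ Icc a b, 0 < cos (κ * (t - m)) := by
    intro t ht
    apply cos_pos_of_mem_Ioo
    constructor <;> nlinarith [ht.1, ht.2]
  have hG : ∀ t ∈ uIcc a b, HasDerivAt (fun t => -κ * tan (κ * (t - m)) * ‖v t‖ ^ 2)
      (‖v' t‖ ^ 2 - κ ^ 2 * ‖v t‖ ^ 2 -
        ‖v' t - (-κ * tan (κ * (t - m))) • v t‖ ^ 2) t := by
    intro t ht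
    rw [uIcc_of_le hab] at ht
    have hc := (hcos t ht).ne'
    have h1 : HasDerivAt (fun t => κ * (t - m)) κ t := by
      simpa using ((hasDerivAt_id t).sub_const m).const_mul κ
    have h2 : HasDerivAt (fun t => tan (κ * (t - m))) (1 / cos (κ * (t - m)) ^ 2 * κ) t :=
      HasDerivAt.comp (h₂ := tan) t (hasDerivAt_tan hc) h1
    have h3 := (hv t).norm_sq
    refine ((h2.const_mul (-κ)).mul h3).congr_deriv ?_
    rw [norm_sub_sq_real, real_inner_smul_right, norm_smul, mul_pow, norm_eq_abs, sq_abs,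
      real_inner_comm (v t) (v' t), one_div, ← inv_one_add_tan_sq hc, inv_inv]
    ring
  have hint : IntervalIntegrable (fun t => ‖v' t‖ ^ 2 - κ ^ 2 * ‖v t‖ ^ 2 -
        ‖v' t - (-κ * tan (κ * (t - m))) • v t‖ ^ 2) volume a b := by
    apply ContinuousOn.intervalIntegrable
    rw [uIcc_of_le hab]
    have htan : ContinuousOn (fun t => tan (κ * (t - m))) (Icc a b) := by
      intro t ht
      exact ((continuousAt_tan.2 (hcos t ht).ne').comp
        (f := fun t => κ * (t - m)) (by fun_prop)).continuousWithinAt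
    have h1 := hvc.continuousOn (s := Icc a b)
    have h2 := hv'.continuousOn (s := Icc a b)
    fun_prop
  have h0 := intervalIntegral.integral_eq_sub_of_hasDerivAt hG hint
  simp only [ha, hb, norm_zero, ne_eq, OfNat.ofNat_ne_zero, not_false_eq_true, zero_pow, mul_zero,
    sub_zero] at h0
  have hi1 : IntervalIntegrable (fun t => ‖v' t‖ ^ 2) volume a b :=
    (hv'.norm.pow 2).intervalIntegrable _ _
  have hi2 : IntervalIntegrable (fun t => κ ^ 2 * ‖v t‖ ^ 2) volume a b :=
    ((hvc.norm.pow 2).intervalIntegrable _ _).const_mul _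
  have h1 := intervalIntegral.integral_mono hab hint (hi1.sub hi2) (fun t => by
    simp only
    linarith [sq_nonneg ‖v' t - (-κ * tan (κ * (t - m))) • v t‖])
  rw [h0, intervalIntegral.integral_sub hi1 hi2, intervalIntegral.integral_const_mul] at h1
  linarith

/-- A set of about `(b - a) κ / π` nodes such that functions vanishing there satisfy
Wirtinger's inequality with constant `κ ^ 2`. -/
lemma exists_wirtinger_nodes {a b κ : ℝ} (hab : a ≤ b) (hκ : 0 ≤ κ) :
    ∃ S : Finset ℝ, (S.card : ℝ) ≤ (b - a) * κ / π + 2 ∧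
      ∀ v v' : ℝ → ℂ, (∀ t, HasDerivAt v (v' t) t) → Continuous v' → (∀ s ∈ S, v s = 0) →
        κ ^ 2 * ∫ t in a..b, ‖v t‖ ^ 2 ≤ ∫ t in a..b, ‖v' t‖ ^ 2 := by
  have hx : 0 ≤ (b - a) * κ / π := div_nonneg (mul_nonneg (by linarith) hκ) pi_pos.le
  set m : ℕ := ⌊(b - a) * κ / π⌋₊ + 1 with hm
  have hm1 : (m : ℝ) ≤ (b - a) * κ / π + 1 := by
    rw [hm]; push_cast; linarith [Nat.floor_le hx]
  have hm2 : (b - a) * κ / π < m := by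
    rw [hm]; push_cast; exact Nat.lt_floor_add_one _
  have hm0 : (0 : ℝ) < m := by rw [hm]; positivity
  set g : ℕ → ℝ := fun i => a + i * ((b - a) / m) with hg
  refine ⟨(Finset.range (m + 1)).image g, ?_, ?_⟩
  · have : (((Finset.range (m + 1)).image g).card : ℝ) ≤ (m + 1 : ℕ) := by
      exact_mod_cast Finset.card_image_le.trans (by simp)
    push_cast at this
    linarith
  · intro v v' hv hv' hS
    have hvc : Continuous v := continuous_iff_continuousAt.2 fun t => (hv t).continuousAt
    have hg0 : g 0 = a := by simp [hg]
    have hgm : g m = b := by simp only [hg]; field_simp; ring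
    have hsum1 := intervalIntegral.sum_integral_adjacent_intervals (μ := volume) (a := g) (n := m)
      (f := fun t => ‖v t‖ ^ 2) (fun k _ => (hvc.norm.pow 2).intervalIntegrable _ _)
    have hsum2 := intervalIntegral.sum_integral_adjacent_intervals (μ := volume) (a := g) (n := m)
      (f := fun t => ‖v' t‖ ^ 2) (fun k _ => (hv'.norm.pow 2).intervalIntegrable _ _)
    rw [hg0, hgm] at hsum1 hsum2
    rw [← hsum1, ← hsum2, Finset.mul_sum]
    refine Finset.sum_le_sum fun i hi => ?_
    rw [Finset.mem_range] at hi
    have hstep : g (i + 1) - g i = (b - a) / m := by simp only [hg]; push_cast; ring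
    have hd : 0 ≤ (b - a) / m := div_nonneg (by linarith) hm0.le
    refine wirtinger_dirichlet (by linarith) hκ ?_ hv hv'
      (hS _ (Finset.mem_image_of_mem g (by simp; omega)))
      (hS _ (Finset.mem_image_of_mem g (by simp; omega)))
    rw [hstep, ← mul_div_assoc, div_lt_iff₀ hm0]
    rw [div_lt_iff₀ pi_pos] at hm2
    linarith

/-- Nodes making the one-dimensional form of a potential with a piecewise constant majorant
nonnegative. -/
lemma exists_channel_nodes {ω : ℝ → ℝ} (hω : Measurable ω)
    (hB : ∀ R, ∃ B, ∀ t, |t| ≤ R → |ω t| ≤ B) {A : ℝ} {g κ : ℕ → ℝ} {J : ℕ} (hg : Monotone g)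
    (hκ : ∀ j, 0 ≤ κ j)
    (hmid : ∀ j < J, ∀ t ∈ Ioo (g j) (g (j + 1)), ω t - A ≤ κ j ^ 2)
    (hleft : ∀ t ≤ g 0, ω t ≤ A) (hright : ∀ t, g J < t → ω t ≤ A) :
    ∃ S : Finset ℝ, (S.card : ℝ) ≤ ∑ j ∈ Finset.range J, ((g (j + 1) - g j) * κ j / π + 2) ∧
      ∀ v v' : ℝ → ℂ, (∀ t, HasDerivAt v (v' t) t) → Continuous v' →
        (∃ R, ∀ t, R < |t| → v t = 0 ∧ v' t = 0) → (∀ s ∈ S, v s = 0) →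
        Integrable (fun t => ‖v' t‖ ^ 2 + (A - ω t) * ‖v t‖ ^ 2) ∧
        0 ≤ ∫ t, (‖v' t‖ ^ 2 + (A - ω t) * ‖v t‖ ^ 2) := by
  choose S hcard hS using fun j => exists_wirtinger_nodes (hg (Nat.le_succ j)) (hκ j)
  refine ⟨(Finset.range J).biUnion S, ?_, ?_⟩
  · calc (((Finset.range J).biUnion S).card : ℝ) ≤ ∑ j ∈ Finset.range J, ((S j).card : ℝ) := by
          exact_mod_cast Finset.card_biUnion_le
      _ ≤ _ := Finset.sum_le_sum fun j _ => hcard j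
  · intro v v' hv hv' ⟨R, hR⟩ hvS
    have hvc : Continuous v := continuous_iff_continuousAt.2 fun t => (hv t).continuousAt
    set h : ℝ → ℝ := fun t => ‖v' t‖ ^ 2 + (A - ω t) * ‖v t‖ ^ 2 with hh
    have hint : Integrable h := by
      obtain ⟨B, hB⟩ := hB R
      have h1 : IntegrableOn h (Icc (-R) R) := by
        refine Integrable.add (hv'.norm.pow 2).integrableOn_Icc ?_
        refine Integrable.bdd_mul (c := |A| + B) (hvc.norm.pow 2).integrableOn_Icc
          (measurable_const.sub hω).aestronglyMeasurable ?_
        refine (ae_restrict_iff' measurableSet_Icc).2 (ae_of_all _ fun t ht => ?_)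
        exact (abs_sub _ _).trans (by linarith [hB t (abs_le.2 ht)])
      rw [← integrableOn_univ]
      refine h1.of_forall_sdiff_eq_zero MeasurableSet.univ fun t ht => ?_
      have : R < |t| := by
        by_contra hcon
        exact ht.2 (abs_le.1 (not_lt.1 hcon))
      simp [hh, hR t this]
    refine ⟨hint, ?_⟩
    have hout : 0 ≤ ∫ t in (Ioc (g 0) (g J))ᶜ, h t := by
      refine setIntegral_nonneg measurableSet_Ioc.compl fun t ht => ?_
      have : ω t ≤ A := by
        by_cases h0 : t ≤ g 0
        · exact hleft t h0
        · refine hright t ?_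
          by_contra hcon
          exact ht ⟨not_le.1 h0, not_lt.1 hcon⟩
      have h2 : 0 ≤ (A - ω t) * ‖v t‖ ^ 2 := mul_nonneg (by linarith) (sq_nonneg _)
      positivity
    rw [← integral_add_compl (measurableSet_Ioc (a := g 0) (b := g J)) hint,
      ← intervalIntegral.integral_of_le (hg (Nat.zero_le J)),
      ← intervalIntegral.sum_integral_adjacent_intervals (fun k _ => hint.intervalIntegrable)]
    refine add_nonneg (Finset.sum_nonneg fun j hj => ?_) hout
    have hi1 : IntervalIntegrable (fun t => ‖v' t‖ ^ 2) volume (g j) (g (j + 1)) :=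
      (hv'.norm.pow 2).intervalIntegrable _ _
    have hi2 : IntervalIntegrable (fun t => κ j ^ 2 * ‖v t‖ ^ 2) volume (g j) (g (j + 1)) :=
      ((hvc.norm.pow 2).intervalIntegrable _ _).const_mul _
    have h1 := intervalIntegral.integral_mono_on_of_le_Ioo (hg (Nat.le_succ j)) (hi1.sub hi2)
      hint.intervalIntegrable (fun t ht => by
        have := hmid j (Finset.mem_range.1 hj) t ht
        simp only [hh]
        nlinarith [sq_nonneg ‖v t‖])
    rw [intervalIntegral.integral_sub hi1 hi2, intervalIntegral.integral_const_mul] at h1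
    have h2 := hS j v v' hv hv' (fun s hs => hvS s (Finset.mem_biUnion.2 ⟨j, hj, hs⟩))
    simp only [Nat.succ_eq_add_one] at h2
    linarith

lemma integrable_mul_of_eq_zero {ω k : ℝ → ℝ} (hω : Measurable ω)
    (hB : ∀ R, ∃ B, ∀ t, |t| ≤ R → |ω t| ≤ B) (hk : Continuous k) {R : ℝ}
    (hR : ∀ t, R < |t| → k t = 0) : Integrable fun t => ω t * k t := by
  obtain ⟨B, hB⟩ := hB R
  have h1 : IntegrableOn (fun t => ω t * k t) (Icc (-R) R) := by
    refine Integrable.bdd_mul (c := B) hk.integrableOn_Icc hω.aestronglyMeasurable ?_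
    exact (ae_restrict_iff' measurableSet_Icc).2 (ae_of_all _ fun t ht => hB t (abs_le.2 ht))
  rw [← integrableOn_univ]
  refine h1.of_forall_sdiff_eq_zero MeasurableSet.univ fun t ht => ?_
  rw [hR t (by by_contra hcon; exact ht.2 (abs_le.1 (not_lt.1 hcon))), mul_zero]

lemma angCoeff_zero (n : ℤ) : angCoeff n (fun _ => 0) = 0 := by simp [angCoeff]

/-- If finitely many angular channels satisfy one-dimensional form bounds, and the other channels
have large angular energy, then the magnetic energy dominates the radial potential. -/
lemma integral_radialPotential_le_magEnergy (Φ : ℝ) {ω : ℝ → ℝ} (hω : Measurable ω)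
    (hB : ∀ R, ∃ B, ∀ t, |t| ≤ R → |ω t| ≤ B) (F : Finset ℤ)
    (hF : ∀ n : ℤ, n ∉ F → ∀ t, ω t ≤ (n - Φ) ^ 2) (S : ℤ → Finset ℝ)
    (hS : ∀ n ∈ F, ∀ v v' : ℝ → ℂ, (∀ t, HasDerivAt v (v' t) t) → Continuous v' →
        (∃ R, ∀ t, R < |t| → v t = 0 ∧ v' t = 0) → (∀ s ∈ S n, v s = 0) →
        Integrable (fun t => ‖v' t‖ ^ 2 + ((n - Φ) ^ 2 - ω t) * ‖v t‖ ^ 2) ∧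
        0 ≤ ∫ t, (‖v' t‖ ^ 2 + ((n - Φ) ^ 2 - ω t) * ‖v t‖ ^ 2))
    {u : ℝ × ℝ → ℂ} (hu : IsTestFun u)
    (hvan : ∀ n ∈ F, ∀ s ∈ S n, angCoeff n (fun θ => (u ∘ logPolar) (s, θ)) = 0) :
    ∫ x, radialPotential ω x * ‖u x‖ ^ 2 ≤ magEnergy Φ u := by
  rw [integral_radialPotential hu hω hB, magEnergy_eq_integral_cylinder Φ hu]
  obtain ⟨R, -, hR⟩ := hu.exists_radius
  have hU := hu.contDiff_comp_logPolar
  have hper : ∀ t, (u ∘ logPolar) (t, -π) = (u ∘ logPolar) (t, π) := by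
    intro t; simp [logPolar]
  set U := u ∘ logPolar with hUdef
  have hUc := hU.continuous
  have hd1 := continuous_fderiv_apply hU (1, 0)
  have hd2 := continuous_fderiv_apply hU (0, 1)
  set e : ℝ → ℝ := fun t => ∫ θ in (-π)..π, cylinderDensity Φ U (t, θ) with he
  set m : ℝ → ℝ := fun t => ∫ θ in (-π)..π, ‖U (t, θ)‖ ^ 2 with hm
  have hec : Continuous e := by
    apply intervalIntegral.continuous_parametric_intervalIntegral_of_continuous'
    exact (continuous_cylinderDensity Φ hU).comp continuous_id
  have hmc : Continuous m := by
    apply intervalIntegral.continuous_parametric_intervalIntegral_of_continuous'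
    exact (hUc.norm.pow 2).comp continuous_id
  have he0 : ∀ t, R < |t| → e t = 0 := by
    intro t ht
    simp only [he]
    simp [fun θ => cylinderDensity_eq_zero Φ hR (t, θ) ht]
  have hm0 : ∀ t, R < |t| → m t = 0 := by
    intro t ht
    simp only [hm]
    simp [fun θ => hR (t, θ) ht.le]
  have hei : Integrable e := by
    have := integrable_mul_of_eq_zero (ω := fun _ => 1) measurable_const
      (fun R => ⟨1, by simp⟩) hec he0
    simpa using this
  have hmi : Integrable fun t => ω t * m t := integrable_mul_of_eq_zero hω hB hmc hm0
  set v : ℤ → ℝ → ℂ := fun n t => angCoeff n fun θ => U (t, θ) with hv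
  set v' : ℤ → ℝ → ℂ := fun n t => angCoeff n fun θ => fderiv ℝ U (t, θ) (1, 0) with hv'
  have hchan : ∀ n ∈ F,
      Integrable (fun t => ‖v' n t‖ ^ 2 + ((n - Φ) ^ 2 - ω t) * ‖v n t‖ ^ 2) ∧
      0 ≤ ∫ t, (‖v' n t‖ ^ 2 + ((n - Φ) ^ 2 - ω t) * ‖v n t‖ ^ 2) := by
    intro n hn
    refine hS n hn (v n) (v' n) (hasDerivAt_angCoeff n hU) (continuous_angCoeff n hd1)
      ⟨R, fun t ht => ?_⟩ (hvan n hn)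
    constructor
    · simp only [hv, fun θ => hR (t, θ) ht.le, angCoeff_zero]
    · simp only [hv', fun θ => fderiv_eq_zero_of_abs_fst_gt hR (t, θ) ht]
      simp [angCoeff_zero]
  have hpt : ∀ t, ∑ n ∈ F, (‖v' n t‖ ^ 2 + ((n - Φ) ^ 2 - ω t) * ‖v n t‖ ^ 2) ≤
      2 * π * (e t - ω t * m t) := by
    intro t
    exact sum_angCoeff_le Φ (ω t) (g := fun θ => U (t, θ))
      (g' := fun θ => fderiv ℝ U (t, θ) (0, 1)) (h := fun θ => fderiv ℝ U (t, θ) (1, 0))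
      (hasDerivAt_snd_slice hU t) (by fun_prop) (hper t) (by fun_prop) F (fun n hn => hF n hn t)
  have hI := integral_mono (integrable_finsetSum F fun n hn => (hchan n hn).1)
    ((hei.sub hmi).const_mul (2 * π)) hpt
  rw [integral_finsetSum F fun n hn => (hchan n hn).1] at hI
  have h0 : 0 ≤ ∑ n ∈ F, ∫ t, (‖v' n t‖ ^ 2 + ((n - Φ) ^ 2 - ω t) * ‖v n t‖ ^ 2) :=
    Finset.sum_nonneg fun n hn => (hchan n hn).2
  have h1 := h0.trans hI
  rw [MeasureTheory.integral_const_mul] at h1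
  have h2 := nonneg_of_mul_nonneg_right h1 (by positivity)
  have h3 : ∫ t, (e - fun t => ω t * m t) t = ∫ t, (e t - ω t * m t) := rfl
  rw [h3, integral_sub hei hmi] at h2
  linarith

lemma angCoeff_add {g h : ℝ → ℂ} (n : ℤ) (hg : Continuous g) (hh : Continuous h) :
    angCoeff n (fun θ => g θ + h θ) = angCoeff n g + angCoeff n h := by
  have := angCoeff_sub_const_mul n hg hh 1 (-1)
  simpa using this

lemma angCoeff_const_mul (n : ℤ) (c : ℂ) (g : ℝ → ℂ) :
    angCoeff n (fun θ => c * g θ) = c * angCoeff n g := by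
  simp only [angCoeff]
  rw [← intervalIntegral.integral_const_mul]
  congr 1
  ext θ
  ring

/-- Variational upper bound on the number of negative eigenvalues: it is at most the number of
nodes needed in all the angular channels. -/
lemma negEigCount_le_card (Φ : ℝ) {W : ℝ × ℝ → ℝ} (hW : Measurable W)
    (hWb : ∃ B, ∀ᵐ x, |W x| ≤ B) {ω : ℝ → ℝ} (hω : Measurable ω)
    (hB : ∀ R, ∃ B, ∀ t, |t| ≤ R → |ω t| ≤ B)
    (hle : ∀ᵐ x, x ≠ 0 → W x ≤ radialPotential ω x) (F : Finset ℤ)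
    (hF : ∀ n : ℤ, n ∉ F → ∀ t, ω t ≤ (n - Φ) ^ 2) (S : ℤ → Finset ℝ)
    (hS : ∀ n ∈ F, ∀ v v' : ℝ → ℂ, (∀ t, HasDerivAt v (v' t) t) → Continuous v' →
        (∃ R, ∀ t, R < |t| → v t = 0 ∧ v' t = 0) → (∀ s ∈ S n, v s = 0) →
        Integrable (fun t => ‖v' t‖ ^ 2 + ((n - Φ) ^ 2 - ω t) * ‖v t‖ ^ 2) ∧
        0 ≤ ∫ t, (‖v' t‖ ^ 2 + ((n - Φ) ^ 2 - ω t) * ‖v t‖ ^ 2)) :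
    negEigCount Φ W ≤ ((∑ n ∈ F, (S n).card : ℕ) : ℝ≥0∞) := by
  refine iSup₂_le fun M hM => ?_
  obtain ⟨hfin, hMt, hMneg⟩ := hM
  rw [← Finset.card_sigma]
  by_contra! hlt
  have hlt' : (F.sigma S).card < Module.finrank ℂ M := by exact_mod_cast hlt
  have hslice : ∀ u : M, ∀ t, Continuous fun θ => ((u : ℝ × ℝ → ℂ) ∘ logPolar) (t, θ) := by
    intro u t
    have := (hMt u u.2).contDiff_comp_logPolar.continuous
    exact this.comp (by fun_prop)
  let T : M →ₗ[ℂ] ((F.sigma S) → ℂ) :=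
    { toFun := fun u i => angCoeff i.1.1 fun θ => ((u : ℝ × ℝ → ℂ) ∘ logPolar) (i.1.2, θ)
      map_add' := fun u v => by
        ext i
        exact angCoeff_add _ (hslice u _) (hslice v _)
      map_smul' := fun c u => by
        ext i
        exact angCoeff_const_mul _ c _ }
  have hker : LinearMap.ker T ≠ ⊥ := by
    apply LinearMap.ker_ne_bot_of_finrank_lt
    simpa using hlt'
  obtain ⟨u, huT, hu0⟩ := (Submodule.ne_bot_iff _).1 hker
  have hu : IsTestFun (u : ℝ × ℝ → ℂ) := hMt u u.2
  have hne : (u : ℝ × ℝ → ℂ) ≠ 0 := fun h => hu0 (Subtype.ext h)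
  have hlow := hMneg u u.2 hne
  have hup := integral_radialPotential_le_magEnergy Φ hω hB F hF S hS hu (fun n hn s hs =>
    congrFun (LinearMap.mem_ker.1 huT) ⟨⟨n, s⟩, Finset.mem_sigma.2 ⟨hn, hs⟩⟩)
  obtain ⟨B, hWb⟩ := hWb
  have hmono : ∫ x, W x * ‖(u : ℝ × ℝ → ℂ) x‖ ^ 2 ≤
      ∫ x, radialPotential ω x * ‖(u : ℝ × ℝ → ℂ) x‖ ^ 2 := by
    refine integral_mono_ae (integrable_mul_norm_sq hu hW (hWb.mono fun x hx _ => hx))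
      (integrable_radialPotential hu hω hB) ?_
    filter_upwards [hle] with x hx
    by_cases h : (u : ℝ × ℝ → ℂ) x = 0
    · simp [h]
    · exact mul_le_mul_of_nonneg_right (hx (hu.ne_zero_of_apply_ne_zero h)) (sq_nonneg _)
  linarith

lemma setIntegral_Ioo_rpow_mul_one_sub_rpow {α β : ℝ} (hα : 0 < α) (hβ : 0 < β) :
    ∫ x in Ioo (0 : ℝ) 1, x ^ (α - 1) * (1 - x) ^ (β - 1) = ProbabilityTheory.beta α β := by
  rw [ProbabilityTheory.beta_eq_betaIntegralReal α β hα hβ, Complex.betaIntegral,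
    intervalIntegral.integral_of_le zero_le_one, ← integral_Ioc_eq_integral_Ioo]
  rw [← Complex.ofReal_re (∫ x in Ioc (0 : ℝ) 1, x ^ (α - 1) * (1 - x) ^ (β - 1)),
    ← integral_complex_ofReal]
  congr 1
  refine setIntegral_congr_fun measurableSet_Ioc fun x hx => ?_
  simp only [Complex.ofReal_mul]
  rw [Complex.ofReal_cpow hx.1.le, Complex.ofReal_cpow (by linarith [hx.2])]
  push_cast
  rfl

lemma integral_sqrt_rpow_sub_one {p : ℝ} (hp : 1 < p) :
    ∫ s in Ioi (0 : ℝ), √(s ^ (-1 / p) - 1) =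
      π * (Gamma (p - 1 / 2) / (2 * √π * Gamma p)) := by
  have hp0 : 0 < p := by linarith
  have h1 : ∫ s in Ioi (0 : ℝ), √(s ^ (-1 / p) - 1) =
      ∫ y in Ioo (0 : ℝ) 1, p * (y ^ ((p - 1 / 2) - 1) * (1 - y) ^ ((3 / 2 : ℝ) - 1)) := by
    rw [← integral_comp_rpow_Ioi (fun s => √(s ^ (-1 / p) - 1)) hp0.ne']
    rw [← integral_indicator measurableSet_Ioi, ← integral_indicator measurableSet_Ioo]
    congr 1
    ext y
    by_cases hy : 0 < y
    · have hy2 : (y ^ p) ^ (-1 / p) = y⁻¹ := by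
        rw [← rpow_mul hy.le, ← rpow_neg_one]
        congr 1
        field_simp
      rw [indicator_of_mem (show y ∈ Ioi (0 : ℝ) from hy)]
      by_cases hy1 : y < 1
      · rw [indicator_of_mem (show y ∈ Ioo (0 : ℝ) 1 from ⟨hy, hy1⟩), hy2, abs_of_pos hp0,
          show y⁻¹ - 1 = y⁻¹ * (1 - y) by field_simp, sqrt_mul (by positivity), sqrt_inv,
          show (3 / 2 : ℝ) - 1 = 1 / 2 by norm_num, ← sqrt_eq_rpow,
          show p - 1 / 2 - 1 = (p - 1) - 1 / 2 by ring, rpow_sub hy (p - 1) (1 / 2), ← sqrt_eq_rpow, smul_eq_mul]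
        ring
      · rw [indicator_of_notMem (fun h => hy1 h.2), hy2, sqrt_eq_zero_of_nonpos, smul_zero]
        have := inv_le_one_of_one_le₀ (not_lt.1 hy1)
        linarith
    · rw [indicator_of_notMem (show y ∉ Ioi (0 : ℝ) from hy),
        indicator_of_notMem (fun h : y ∈ Ioo (0 : ℝ) 1 => hy h.1)]
  rw [h1, integral_const_mul, setIntegral_Ioo_rpow_mul_one_sub_rpow (by linarith) (by norm_num),
    ProbabilityTheory.beta, show p - 1 / 2 + 3 / 2 = p + 1 by ring, Gamma_add_one hp0.ne',
    show (3 / 2 : ℝ) = 1 / 2 + 1 by norm_num, Gamma_add_one (by norm_num), Gamma_one_half_eq]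
  have h2 : 0 < Gamma p := Gamma_pos_of_pos hp0
  have h3 : 0 < √π := sqrt_pos.2 pi_pos
  have h4 : √π ^ 2 = π := sq_sqrt pi_pos.le
  field_simp
  rw [h4]

lemma integral_sqrt_mul_rpow_sub_sq {p : ℝ} (hp : 1 < p) {Λ a : ℝ} (hΛ : 0 < Λ) (ha : 0 < a) :
    ∫ t in Ioi (0 : ℝ), √(Λ * t ^ (-1 / p) - a ^ 2) =
      π * (Gamma (p - 1 / 2) / (2 * √π * Gamma p)) * (Λ ^ p * a ^ (1 - 2 * p)) := by
  have hp0 : 0 < p := by linarith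
  set K := (Λ / a ^ 2) ^ p with hK
  have hK0 : 0 < K := by positivity
  have h := integral_comp_mul_left_Ioi (fun t => √(Λ * t ^ (-1 / p) - a ^ 2)) 0 hK0
  rw [mul_zero, smul_eq_mul] at h
  have h2 : ∫ s in Ioi (0 : ℝ), √(Λ * (K * s) ^ (-1 / p) - a ^ 2) =
      ∫ s in Ioi (0 : ℝ), a * √(s ^ (-1 / p) - 1) := by
    refine setIntegral_congr_fun measurableSet_Ioi fun s hs => ?_
    have hs0 : (0 : ℝ) < s := hs
    have hK1 : K ^ (-1 / p) = a ^ 2 / Λ := by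
      rw [hK, ← rpow_mul (by positivity), show p * (-1 / p) = -1 by field_simp, rpow_neg_one,
        inv_div]
    rw [mul_rpow hK0.le hs0.le, hK1,
      show Λ * (a ^ 2 / Λ * s ^ (-1 / p)) - a ^ 2 = a ^ 2 * (s ^ (-1 / p) - 1) by
        field_simp, sqrt_mul (by positivity), sqrt_sq ha.le]
  rw [h2, integral_const_mul, integral_sqrt_rpow_sub_one hp] at h
  have h3 : ∫ t in Ioi (0 : ℝ), √(Λ * t ^ (-1 / p) - a ^ 2) =
      K * (a * (π * (Gamma (p - 1 / 2) / (2 * √π * Gamma p)))) := by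
    rw [h]; field_simp
  rw [h3, hK, div_rpow hΛ.le (by positivity), ← rpow_natCast a 2, ← rpow_mul ha.le,
    rpow_sub ha, rpow_one]
  push_cast
  ring

lemma integrableOn_sqrt_mul_rpow_sub_sq {p : ℝ} (hp : 1 < p) {Λ a : ℝ} (hΛ : 0 < Λ)
    (ha : 0 < a) : IntegrableOn (fun t : ℝ => √(Λ * t ^ (-1 / p) - a ^ 2)) (Ioi 0) := by
  have hp0 : 0 < p := by linarith
  have h := integral_sqrt_mul_rpow_sub_sq hp hΛ ha
  by_contra hcon
  rw [integral_undef hcon] at h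
  have h2 : 0 < Gamma p := Gamma_pos_of_pos hp0
  have h3 : 0 < √π := sqrt_pos.2 pi_pos
  have h4 : 0 < Gamma (p - 1 / 2) := Gamma_pos_of_pos (by linarith)
  have : 0 < π * (Gamma (p - 1 / 2) / (2 * √π * Gamma p)) * (Λ ^ p * a ^ (1 - 2 * p)) := by
    positivity
  linarith

lemma exists_pos_le_abs_int_sub {Φ : ℝ} (hΦ : ∀ k : ℤ, Φ ≠ k) :
    ∃ d : ℝ, 0 < d ∧ ∀ n : ℤ, d ≤ |(n : ℝ) - Φ| := by
  refine ⟨|Φ - round Φ|, abs_pos.2 (sub_ne_zero.2 (hΦ _)), fun n => ?_⟩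
  rw [abs_sub_comm (n : ℝ)]
  exact round_le Φ n

lemma summable_abs_int_sub_rpow (Φ : ℝ) {p : ℝ} (hp : 1 < p) :
    Summable fun n : ℤ => |(n : ℝ) - Φ| ^ (1 - 2 * p) := by
  have h := (Real.summable_one_div_int_add_rpow (-Φ) (2 * p - 1)).2 (by linarith)
  refine h.congr fun n => ?_
  rw [← sub_eq_add_neg, one_div, ← rpow_neg (abs_nonneg _)]
  congr 1
  ring

lemma le_sq_sqrt (y : ℝ) : y ≤ √y ^ 2 := by
  rcases le_total 0 y with h | h
  · rw [sq_sqrt h]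
  · exact h.trans (sq_nonneg _)

lemma sqrt_mul_rpow_sub_sq_eq_zero {p : ℝ} (hp : 0 < p) {Λ a t : ℝ} (hΛ : 0 < Λ) (ha : 0 < a)
    (ht : (Λ / a ^ 2) ^ p ≤ t) : Λ * t ^ (-1 / p) ≤ a ^ 2 := by
  have h1 : 0 < (Λ / a ^ 2) ^ p := by positivity
  have h2 : t ^ (-1 / p) ≤ ((Λ / a ^ 2) ^ p) ^ (-1 / p) :=
    rpow_le_rpow_of_nonpos h1 ht (by rw [neg_div]; have := one_div_pos.2 hp; linarith)
  rw [← rpow_mul (by positivity), show p * (-1 / p) = -1 by field_simp, rpow_neg_one, inv_div] at h2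
  calc Λ * t ^ (-1 / p) ≤ Λ * (a ^ 2 / Λ) := by gcongr
    _ = a ^ 2 := by field_simp

section Grid

variable {p : ℝ} {Λ a σ T : ℝ}

lemma intervalIntegrable_sqrt_mul_rpow_sub_sq (hp : 1 < p) (hΛ : 0 < Λ) (ha : 0 < a) {s t : ℝ}
    (hs : 0 ≤ s) (hst : s ≤ t) :
    IntervalIntegrable (fun t : ℝ => √(Λ * t ^ (-1 / p) - a ^ 2)) volume s t := by
  rw [intervalIntegrable_iff_integrableOn_Ioc_of_le hst]
  exact (integrableOn_sqrt_mul_rpow_sub_sq hp hΛ ha).mono_set fun x hx => hs.trans_lt hx.1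

lemma sum_grid_le_integral (hp : 1 < p) (hΛ : 0 < Λ) (ha : 0 < a) (hσ : 1 < σ) (hT : 0 < T)
    (J : ℕ) :
    ∑ j ∈ Finset.range J, (T * σ ^ (j + 1) - T * σ ^ j) * √(Λ * (T * σ ^ j) ^ (-1 / p) - a ^ 2) ≤
      ∫ t in Ioi (0 : ℝ), √(Λ * σ ^ (1 / p) * t ^ (-1 / p) - a ^ 2) := by
  have hp0 : 0 < p := by linarith
  have hσ0 : 0 < σ := by linarith
  have hΛ' : 0 < Λ * σ ^ (1 / p) := by positivity
  have hmono : ∀ j : ℕ, T * σ ^ j ≤ T * σ ^ (j + 1) := fun j => by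
    gcongr
    · exact hσ.le
    · omega
  have hint : ∀ j : ℕ, IntervalIntegrable (fun t : ℝ => √(Λ * σ ^ (1 / p) * t ^ (-1 / p) - a ^ 2))
      volume (T * σ ^ j) (T * σ ^ (j + 1)) := fun j =>
    intervalIntegrable_sqrt_mul_rpow_sub_sq hp hΛ' ha (by positivity) (hmono j)
  calc _ ≤ ∑ j ∈ Finset.range J, ∫ t in (T * σ ^ j)..(T * σ ^ (j + 1)),
        √(Λ * σ ^ (1 / p) * t ^ (-1 / p) - a ^ 2) := by
        refine Finset.sum_le_sum fun j _ => ?_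
        rw [← smul_eq_mul, ← intervalIntegral.integral_const]
        refine intervalIntegral.integral_mono_on (hmono j) intervalIntegrable_const (hint j) ?_
        intro t ht
        apply sqrt_le_sqrt
        have h0 : 0 < T * σ ^ j := by positivity
        have ht0 : 0 < t := h0.trans_le ht.1
        have h1 : (T * σ ^ j * σ) ^ (-1 / p) ≤ t ^ (-1 / p) :=
          rpow_le_rpow_of_nonpos ht0 (by rw [mul_assoc, ← pow_succ]; exact ht.2)
            (by rw [neg_div]; have := one_div_pos.2 hp0; linarith)
        have h2 : σ ^ (1 / p) * (T * σ ^ j * σ) ^ (-1 / p) = (T * σ ^ j) ^ (-1 / p) := by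
          rw [mul_rpow h0.le hσ0.le, neg_div, rpow_neg hσ0.le]
          field_simp
        rw [← h2, ← mul_assoc]
        gcongr
    _ = ∫ t in (T * σ ^ 0)..(T * σ ^ J), √(Λ * σ ^ (1 / p) * t ^ (-1 / p) - a ^ 2) :=
        intervalIntegral.sum_integral_adjacent_intervals (a := fun j => T * σ ^ j)
          fun j _ => hint j
    _ ≤ _ := by
        rw [intervalIntegral.integral_of_le (monotone_nat_of_le_succ hmono (Nat.zero_le J))]
        refine setIntegral_mono_set (integrableOn_sqrt_mul_rpow_sub_sq hp hΛ' ha)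
          (ae_of_all _ fun t => sqrt_nonneg _) (ae_of_all _ fun t ht => ?_)
        exact lt_trans (by positivity) ht.1

lemma integral_le_sum_grid (hp : 1 < p) (hΛ : 0 < Λ) (ha : 0 < a) (hσ : 1 < σ) (hT : 0 < T)
    {J : ℕ} (hJ : (Λ * σ ^ (-1 / p) / a ^ 2) ^ p ≤ T * σ ^ J) :
    (∫ t in Ioi (0 : ℝ), √(Λ * σ ^ (-1 / p) * t ^ (-1 / p) - a ^ 2)) -
        √Λ * ∫ t in (0 : ℝ)..T, √(t ^ (-1 / p)) ≤
      ∑ j ∈ Finset.range J,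
        (T * σ ^ (j + 1) - T * σ ^ j) * √(Λ * (T * σ ^ (j + 1)) ^ (-1 / p) - a ^ 2) := by
  have hp0 : 0 < p := by linarith
  have hσ0 : 0 < σ := by linarith
  have hΛ' : 0 < Λ * σ ^ (-1 / p) := by positivity
  have hneg : -1 / p ≤ 0 := by rw [neg_div]; have := one_div_pos.2 hp0; linarith
  have hmono : ∀ j : ℕ, T * σ ^ j ≤ T * σ ^ (j + 1) := fun j => by
    gcongr
    · exact hσ.le
    · omega
  set f : ℝ → ℝ := fun t => √(Λ * σ ^ (-1 / p) * t ^ (-1 / p) - a ^ 2) with hf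
  have hint : ∀ j : ℕ, IntervalIntegrable f volume (T * σ ^ j) (T * σ ^ (j + 1)) := fun j =>
    intervalIntegrable_sqrt_mul_rpow_sub_sq hp hΛ' ha (by positivity) (hmono j)
  have hTJ : T ≤ T * σ ^ J := by
    simpa using monotone_nat_of_le_succ hmono (Nat.zero_le J)
  have hsplit : ∫ t in Ioi (0 : ℝ), f t = (∫ t in (0 : ℝ)..T, f t) + ∫ t in T..(T * σ ^ J), f t := by
    rw [intervalIntegral.integral_add_adjacent_intervals
      (intervalIntegrable_sqrt_mul_rpow_sub_sq hp hΛ' ha le_rfl hT.le)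
      (intervalIntegrable_sqrt_mul_rpow_sub_sq hp hΛ' ha hT.le hTJ),
      intervalIntegral.integral_of_le (hT.le.trans hTJ)]
    refine setIntegral_eq_of_subset_of_forall_sdiff_eq_zero measurableSet_Ioi
      (fun t ht => ht.1) fun t ht => ?_
    refine sqrt_eq_zero_of_nonpos (sub_nonpos.2
      (sqrt_mul_rpow_sub_sq_eq_zero hp0 hΛ' ha (hJ.trans ?_)))
    by_contra! hlt
    exact ht.2 ⟨ht.1, hlt.le⟩
  have h0 : ∫ t in (0 : ℝ)..T, f t ≤ √Λ * ∫ t in (0 : ℝ)..T, √(t ^ (-1 / p)) := by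
    rw [← intervalIntegral.integral_const_mul]
    refine intervalIntegral.integral_mono_on hT.le
      (intervalIntegrable_sqrt_mul_rpow_sub_sq hp hΛ' ha le_rfl hT.le) ?_ fun t ht => ?_
    · refine IntervalIntegrable.const_mul ?_ _
      have h1 : IntervalIntegrable (fun t : ℝ => t ^ (-1 / p * (1 / 2))) volume 0 T := by
        apply intervalIntegral.intervalIntegrable_rpow'
        have : 1 / p < 1 := by rw [div_lt_one hp0]; exact hp
        rw [neg_div]; linarith
      refine h1.congr fun t ht => ?_
      rw [uIoc_of_le hT.le] at ht
      rw [rpow_mul ht.1.le, ← sqrt_eq_rpow]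
    · rw [← sqrt_mul hΛ.le]
      apply sqrt_le_sqrt
      have : σ ^ (-1 / p) ≤ 1 := rpow_le_one_of_one_le_of_nonpos hσ.le hneg
      have h2 : 0 ≤ t ^ (-1 / p) := rpow_nonneg ht.1 _
      have h3 : Λ * σ ^ (-1 / p) * t ^ (-1 / p) ≤ Λ * 1 * t ^ (-1 / p) := by gcongr
      nlinarith [sq_nonneg a]
  have h1 : ∫ t in T..(T * σ ^ J), f t = ∑ j ∈ Finset.range J,
      ∫ t in (T * σ ^ j)..(T * σ ^ (j + 1)), f t := by
    rw [intervalIntegral.sum_integral_adjacent_intervals (a := fun j => T * σ ^ j)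
      fun j _ => hint j]
    simp
  have h2 : ∫ t in T..(T * σ ^ J), f t ≤ ∑ j ∈ Finset.range J,
        (T * σ ^ (j + 1) - T * σ ^ j) * √(Λ * (T * σ ^ (j + 1)) ^ (-1 / p) - a ^ 2) := by
    rw [h1]
    refine Finset.sum_le_sum fun j _ => ?_
    rw [← smul_eq_mul (_ - _), ← intervalIntegral.integral_const]
    refine intervalIntegral.integral_mono_on (hmono j) (hint j) intervalIntegrable_const ?_
    intro t ht
    apply sqrt_le_sqrt
    have h0 : 0 < T * σ ^ j := by positivity
    have ht0 : 0 < t := h0.trans_le ht.1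
    have h1 : t ^ (-1 / p) ≤ (T * σ ^ j) ^ (-1 / p) := rpow_le_rpow_of_nonpos h0 ht.1 hneg
    have h2 : σ ^ (-1 / p) * (T * σ ^ j) ^ (-1 / p) = (T * σ ^ (j + 1)) ^ (-1 / p) := by
      rw [pow_succ, ← mul_assoc, mul_rpow h0.le hσ0.le, mul_comm]
    rw [← h2, ← mul_assoc]
    gcongr
  linarith

end Grid

/-- The asymptotics of the potential in terms of the logarithmic radius. -/
lemma exists_radial_bounds {p : ℝ} {V : ℝ × ℝ → ℝ}
    (hVasymp : Filter.Tendsto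
      (fun x : ℝ × ℝ => sqnorm x * Real.log (Real.sqrt (sqnorm x)) ^ (1 / p) * V x)
      (Filter.cocompact (ℝ × ℝ)) (nhds 1)) {σ : ℝ} (hσ : 1 < σ) :
    ∃ T : ℝ, 1 ≤ T ∧ ∀ x : ℝ × ℝ, T ≤ log (sqnorm x) / 2 →
      V x ≤ σ * (log (sqnorm x) / 2) ^ (-1 / p) / sqnorm x ∧
      σ⁻¹ * (log (sqnorm x) / 2) ^ (-1 / p) / sqnorm x ≤ V x := by
  have hσ0 : 0 < σ := by linarith
  have h1 := hVasymp.eventually (Ioo_mem_nhds (inv_lt_one_of_one_lt₀ hσ) hσ)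
  obtain ⟨K, hK, hKs⟩ := Filter.mem_cocompact.1 h1
  obtain ⟨R, hR⟩ := hK.isBounded.exists_norm_le
  refine ⟨max 1 (R ^ 2), le_max_left _ _, fun x hx => ?_⟩
  have ht1 : 1 ≤ log (sqnorm x) / 2 := (le_max_left _ _).trans hx
  have hs0 : 0 < sqnorm x := by
    by_contra! hcon
    have h0 : sqnorm x = 0 := le_antisymm hcon (by unfold sqnorm; positivity)
    rw [h0] at ht1
    norm_num at ht1
  have hxK : x ∈ Kᶜ := by
    intro hmem
    have h2 := hR x hmem
    have h3 : |x.1| ≤ R := (norm_fst_le x).trans h2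
    have h4 : |x.2| ≤ R := (norm_snd_le x).trans h2
    have h5 : sqnorm x ≤ 2 * R ^ 2 := by
      unfold sqnorm
      have := sq_le_sq' (abs_le.1 h3).1 (abs_le.1 h3).2
      have := sq_le_sq' (abs_le.1 h4).1 (abs_le.1 h4).2
      linarith
    have h6 := log_le_sub_one_of_pos hs0
    have h7 : R ^ 2 ≤ log (sqnorm x) / 2 := (le_max_right _ _).trans hx
    linarith
  have h2 := hKs hxK
  rw [mem_ofPred_eq] at h2
  rw [log_sqrt hs0.le] at h2
  have h3 : 0 < (log (sqnorm x) / 2) ^ (1 / p) := rpow_pos_of_pos (by linarith) _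
  rw [neg_div, rpow_neg (by linarith)]
  constructor
  · rw [le_div_iff₀ hs0, ← div_eq_mul_inv, le_div_iff₀ h3]
    linarith [h2.2]
  · rw [div_le_iff₀ hs0, ← div_eq_mul_inv, div_le_iff₀ h3]
    linarith [h2.1]

/-- The radial majorant used for the upper bound. -/
noncomputable def radialMajorant (p B σ T t : ℝ) : ℝ :=
  if t < T then B * exp (2 * t) else σ * t ^ (-1 / p)

lemma measurable_radialMajorant (p B σ T : ℝ) : Measurable (radialMajorant p B σ T) := by
  unfold radialMajorant
  refine Measurable.ite measurableSet_Iio ?_ ?_ <;> fun_prop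

lemma radialMajorant_nonneg {p B σ T : ℝ} (hB : 0 < B) (hσ : 0 < σ) (hT : 1 ≤ T) (t : ℝ) :
    0 ≤ radialMajorant p B σ T t := by
  unfold radialMajorant
  split_ifs with h
  · positivity
  · have : 0 ≤ t := by linarith
    positivity

lemma radialMajorant_le {p B σ T : ℝ} (hp : 0 < p) (hB : 0 < B) (hσ : 0 < σ) (hT : 1 ≤ T)
    (t : ℝ) : radialMajorant p B σ T t ≤ B * exp (2 * T) + σ := by
  unfold radialMajorant
  split_ifs with h
  · have : exp (2 * t) ≤ exp (2 * T) := exp_le_exp.2 (by linarith)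
    nlinarith
  · have h1 : t ^ (-1 / p) ≤ 1 := rpow_le_one_of_one_le_of_nonpos (by linarith)
      (by rw [neg_div]; have := one_div_pos.2 hp; linarith)
    have h2 : 0 < B * exp (2 * T) := by positivity
    nlinarith

lemma le_radialPotential_radialMajorant {p B σ T lam : ℝ} {V : ℝ × ℝ → ℝ} (hlam : 0 < lam)
    (hT : ∀ x : ℝ × ℝ, T ≤ log (sqnorm x) / 2 →
      V x ≤ σ * (log (sqnorm x) / 2) ^ (-1 / p) / sqnorm x) {x : ℝ × ℝ} (hx : x ≠ 0)
    (hB : |V x| ≤ B) :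
    lam * V x ≤ radialPotential (fun t => lam * radialMajorant p B σ T t) x := by
  obtain ⟨q, rfl⟩ := exists_logPolar_eq hx
  rw [radialPotential, mul_div_assoc]
  gcongr
  unfold radialMajorant
  split_ifs with h
  · have h1 : B * exp (2 * (log (sqnorm (logPolar q)) / 2)) / sqnorm (logPolar q) = B := by
      rw [sqnorm_logPolar, log_exp]
      field_simp
    rw [h1]
    exact (abs_le.1 hB).2
  · exact hT _ (not_lt.1 h)

/-- The grid of logarithmic radii: one long interval followed by geometric ones. -/
noncomputable def radialGrid (lam T σ : ℝ) : ℕ → ℝ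
  | 0 => -log lam
  | j + 1 => T * σ ^ j

lemma monotone_radialGrid {lam T σ : ℝ} (hlam : 1 ≤ lam) (hT : 0 < T) (hσ : 1 < σ) :
    Monotone (radialGrid lam T σ) := by
  refine monotone_nat_of_le_succ fun j => ?_
  cases j with
  | zero =>
    simp only [radialGrid, pow_zero, mul_one]
    linarith [log_nonneg hlam]
  | succ j =>
    simp only [radialGrid]
    gcongr
    · exact hσ.le
    · omega

/-- The nodes for a single angular channel. -/
lemma exists_nodes_of_channel {p B σ T lam d a : ℝ} (hp : 1 < p) (hB : 0 < B) (hσ : 1 < σ)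
    (hT : 1 ≤ T) (hd : 0 < d) (ha : d ≤ |a|) (hlam : 1 ≤ lam) (hlamB : B / d ^ 2 ≤ lam)
    (hlamσ : σ / d ^ 2 ≤ lam) {J : ℕ} (hJ : 2 * p * log lam ≤ J * log σ) :
    ∃ S : Finset ℝ, (S.card : ℝ) ≤
        Gamma (p - 1 / 2) / (2 * √π * Gamma p) * σ ^ (p + 1) * lam ^ p * |a| ^ (1 - 2 * p) +
          ((T + log lam) * √(lam * (B * exp (2 * T) + σ)) + 2 + 2 * J) ∧
      ∀ v v' : ℝ → ℂ, (∀ t, HasDerivAt v (v' t) t) → Continuous v' →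
        (∃ R, ∀ t, R < |t| → v t = 0 ∧ v' t = 0) → (∀ s ∈ S, v s = 0) →
        Integrable (fun t => ‖v' t‖ ^ 2 + (a ^ 2 - lam * radialMajorant p B σ T t) * ‖v t‖ ^ 2) ∧
        0 ≤ ∫ t, (‖v' t‖ ^ 2 + (a ^ 2 - lam * radialMajorant p B σ T t) * ‖v t‖ ^ 2) := by
  have hp0 : 0 < p := by linarith
  have hσ0 : 0 < σ := by linarith
  have hlam0 : 0 < lam := by linarith
  have hT0 : 0 < T := by linarith
  have ha0 : 0 < |a| := hd.trans_le ha
  have hda : d ^ 2 ≤ a ^ 2 := by rw [← sq_abs a]; gcongr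
  have hneg : -1 / p ≤ 0 := by rw [neg_div]; have := one_div_pos.2 hp0; linarith
  set M := B * exp (2 * T) + σ with hM
  have hM0 : 0 < M := by positivity
  have hmaj0 := radialMajorant_nonneg (p := p) hB hσ0 hT
  have hmaj := radialMajorant_le hp0 hB hσ0 hT
  set g := radialGrid lam T σ with hg
  set κ : ℕ → ℝ := fun j => Nat.casesOn j (√(lam * M))
    (fun j => √(lam * σ * (T * σ ^ j) ^ (-1 / p) - |a| ^ 2)) with hκ
  have hmid : ∀ j < J + 1, ∀ t ∈ Ioo (g j) (g (j + 1)),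
      lam * radialMajorant p B σ T t - a ^ 2 ≤ κ j ^ 2 := by
    intro j _ t ht
    cases j with
    | zero =>
      have h1 : κ 0 = √(lam * M) := rfl
      rw [h1, sq_sqrt (by positivity)]
      have h2 := hmaj t
      have h3 : lam * radialMajorant p B σ T t ≤ lam * M := by gcongr
      linarith [sq_nonneg a]
    | succ j =>
      refine le_trans ?_ (le_sq_sqrt _)
      have ht1 : T * σ ^ j < t := ht.1
      have hTj : T ≤ T * σ ^ j := le_mul_of_one_le_right hT0.le (one_le_pow₀ hσ.le)
      have h1 : t ^ (-1 / p) ≤ (T * σ ^ j) ^ (-1 / p) :=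
        rpow_le_rpow_of_nonpos (by linarith) ht1.le hneg
      rw [radialMajorant, if_neg (by linarith), sq_abs, mul_assoc lam]
      gcongr
  have hleft : ∀ t ≤ g 0, lam * radialMajorant p B σ T t ≤ a ^ 2 := by
    intro t ht
    have ht0 : t ≤ -log lam := ht
    have hl : 0 ≤ log lam := log_nonneg hlam
    rw [radialMajorant, if_pos (by linarith)]
    have h1 : exp (2 * t) ≤ (lam ^ 2)⁻¹ := by
      rw [← exp_log (show 0 < (lam ^ 2)⁻¹ by positivity), log_inv, log_pow]
      apply exp_le_exp.2
      push_cast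
      linarith
    calc lam * (B * exp (2 * t)) ≤ lam * (B * (lam ^ 2)⁻¹) := by gcongr
      _ = B / lam := by field_simp
      _ ≤ d ^ 2 := by
        rw [div_le_iff₀ hlam0]
        rw [div_le_iff₀ (by positivity)] at hlamB
        linarith
      _ ≤ a ^ 2 := hda
  have hright : ∀ t, g (J + 1) < t → lam * radialMajorant p B σ T t ≤ a ^ 2 := by
    intro t ht
    have ht1 : T * σ ^ J < t := ht
    have hTj : T ≤ T * σ ^ J := le_mul_of_one_le_right hT0.le (one_le_pow₀ hσ.le)
    rw [radialMajorant, if_neg (by linarith), ← mul_assoc]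
    refine (sqrt_mul_rpow_sub_sq_eq_zero hp0 (by positivity) hd ?_).trans hda
    have h1 : lam * σ / d ^ 2 ≤ lam ^ (2 : ℝ) := by
      rw [rpow_two, sq lam, mul_div_assoc]
      gcongr
    have h2 : lam ^ (2 * p) ≤ σ ^ J := by
      rw [← rpow_natCast, rpow_def_of_pos hlam0, rpow_def_of_pos hσ0]
      apply exp_le_exp.2
      linarith
    calc (lam * σ / d ^ 2) ^ p ≤ (lam ^ (2 : ℝ)) ^ p := by gcongr
      _ = lam ^ (2 * p) := by rw [rpow_mul hlam0.le]
      _ ≤ σ ^ J := h2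
      _ ≤ T * σ ^ J := le_mul_of_one_le_left (by positivity) hT
      _ ≤ t := ht1.le
  obtain ⟨S, hcard, hS⟩ := exists_channel_nodes (A := a ^ 2) (g := g) (κ := κ) (J := J + 1)
    ((measurable_radialMajorant p B σ T).const_mul lam)
    (fun R => ⟨lam * M, fun t _ => by
      rw [abs_of_nonneg (mul_nonneg hlam0.le (hmaj0 t))]
      have := hmaj t
      gcongr⟩)
    (monotone_radialGrid hlam hT0 hσ) (fun j => by cases j <;> exact sqrt_nonneg _) hmid hleft hright
  refine ⟨S, hcard.trans ?_, hS⟩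
  rw [Finset.sum_add_distrib, Finset.sum_range_succ']
  have h1 : ∑ j ∈ Finset.range J, (g (j + 1 + 1) - g (j + 1)) * κ (j + 1) / π ≤
      Gamma (p - 1 / 2) / (2 * √π * Gamma p) * σ ^ (p + 1) * lam ^ p * |a| ^ (1 - 2 * p) := by
    rw [← Finset.sum_div, div_le_iff₀ pi_pos]
    have h2 := sum_grid_le_integral (Λ := lam * σ) (a := |a|) hp (by positivity) ha0 hσ hT0 J
    rw [integral_sqrt_mul_rpow_sub_sq hp (by positivity) ha0] at h2
    refine h2.trans (le_of_eq ?_)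
    rw [mul_assoc lam, mul_rpow hlam0.le (by positivity), mul_rpow hσ0.le (by positivity),
      ← rpow_mul hσ0.le, show 1 / p * p = 1 by field_simp, rpow_add hσ0]
    ring
  have h3 : (g (0 + 1) - g 0) * κ 0 / π ≤ (T + log lam) * √(lam * M) := by
    have h4 : g (0 + 1) - g 0 = T + log lam := by simp [hg, radialGrid]
    have h5 : κ 0 = √(lam * M) := rfl
    rw [h4, h5]
    have h6 : 0 ≤ log lam := log_nonneg hlam
    exact div_le_self (by positivity) (by linarith [pi_gt_three])
  rw [Finset.sum_const, Finset.card_range, nsmul_eq_mul]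
  push_cast
  linarith

/-- Upper bound for the number of negative eigenvalues. -/
lemma exists_negEigCount_le {Φ : ℝ} (hΦ : ∀ k : ℤ, Φ ≠ k) {p : ℝ} (hp : 1 < p)
    {V : ℝ × ℝ → ℝ} (hVmeas : Measurable V) (hVbdd : ∃ B : ℝ, ∀ᵐ x : ℝ × ℝ, |V x| ≤ B)
    (hVasymp : Filter.Tendsto
      (fun x : ℝ × ℝ => sqnorm x * Real.log (Real.sqrt (sqnorm x)) ^ (1 / p) * V x)
      (Filter.cocompact (ℝ × ℝ)) (nhds 1)) {σ : ℝ} (hσ : 1 < σ) :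
    ∃ C : ℝ, ∀ᶠ lam : ℝ in Filter.atTop, negEigCount Φ (fun x => lam * V x) ≤
      ENNReal.ofReal (σ ^ (p + 1) * lam ^ p * (Gamma (p - 1 / 2) / (2 * √π * Gamma p) *
        ∑' n : ℤ, |(n : ℝ) - Φ| ^ (1 - 2 * p)) + C * (lam * (1 + log lam))) := by
  have hp0 : 0 < p := by linarith
  have hσ0 : 0 < σ := by linarith
  obtain ⟨B₀, hB₀⟩ := hVbdd
  obtain ⟨B, hB, hVB⟩ : ∃ B : ℝ, 0 < B ∧ ∀ᵐ x : ℝ × ℝ, |V x| ≤ B :=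
    ⟨max B₀ 1, by positivity, hB₀.mono fun x hx => hx.trans (le_max_left _ _)⟩
  obtain ⟨T, hT, hTV⟩ := exists_radial_bounds hVasymp hσ
  obtain ⟨d, hd, hdn⟩ := exists_pos_le_abs_int_sub hΦ
  have hlogσ : 0 < log σ := log_pos hσ
  set M := B * exp (2 * T) + σ with hM
  have hM0 : 0 < M := by positivity
  set c := Gamma (p - 1 / 2) / (2 * √π * Gamma p) with hc
  have hc0 : 0 ≤ c := by
    have h1 : 0 < Gamma (p - 1 / 2) := Gamma_pos_of_pos (by linarith)
    have h2 : 0 < Gamma p := Gamma_pos_of_pos hp0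
    positivity
  set K := 2 * p / log σ with hK
  have hK0 : 0 < K := by positivity
  refine ⟨(2 * |Φ| + 2 * √M + 5) * ((T + 1) * √M + 4 + 2 * K), ?_⟩
  filter_upwards [Filter.eventually_ge_atTop 1, Filter.eventually_ge_atTop (B / d ^ 2),
    Filter.eventually_ge_atTop (σ / d ^ 2)] with lam h1 h2 h3
  have hlam0 : 0 < lam := by linarith
  have hl : 0 ≤ log lam := log_nonneg h1
  set N : ℕ := ⌈|Φ| + √(lam * M)⌉₊ with hN
  set J : ℕ := ⌈K * log lam⌉₊ with hJ
  have hJ1 : K * log lam ≤ J := Nat.le_ceil _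
  have hJ2 : (J : ℝ) ≤ K * log lam + 1 := (Nat.ceil_lt_add_one (by positivity)).le
  have hN1 : |Φ| + √(lam * M) ≤ N := Nat.le_ceil _
  have hN2 : (N : ℝ) ≤ |Φ| + √(lam * M) + 1 := (Nat.ceil_lt_add_one (by positivity)).le
  set F : Finset ℤ := Finset.Icc (-(N : ℤ)) N with hF
  have hFcard : (F.card : ℝ) = 2 * N + 1 := by
    rw [hF, Int.card_Icc, show ((N : ℤ) + 1 - -(N : ℤ)).toNat = 2 * N + 1 by omega]
    push_cast
    ring
  have hJσ : 2 * p * log lam ≤ J * log σ := by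
    have h4 : K * log lam * log σ ≤ J * log σ := by gcongr
    have h5 : K * log lam * log σ = 2 * p * log lam := by rw [hK]; field_simp
    linarith
  choose S hcard hS using fun n : ℤ => exists_nodes_of_channel (a := (n : ℝ) - Φ) hp hB hσ hT hd
    (hdn n) h1 h2 h3 hJσ
  have hmaj0 := radialMajorant_nonneg (p := p) hB hσ0 hT
  have hmaj := radialMajorant_le hp0 hB hσ0 hT
  have hmajlam : ∀ t, lam * radialMajorant p B σ T t ≤ lam * M := fun t => by
    have := hmaj t
    gcongr
  have key := negEigCount_le_card Φ (W := fun x => lam * V x) (hVmeas.const_mul lam)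
    ⟨lam * B, hVB.mono fun x hx => by rw [abs_mul, abs_of_pos hlam0]; gcongr⟩
    ((measurable_radialMajorant p B σ T).const_mul lam)
    (fun R => ⟨lam * M, fun t _ => by
      rw [abs_of_nonneg (mul_nonneg hlam0.le (hmaj0 t))]; exact hmajlam t⟩)
    (hVB.mono fun x hx hx0 => le_radialPotential_radialMajorant hlam0
      (fun y hy => (hTV y hy).1) hx0 hx) F ?_ S (fun n _ => hS n)
  · refine key.trans ?_
    rw [← ENNReal.ofReal_natCast]
    apply ENNReal.ofReal_le_ofReal
    push_cast
    have hsq : √(lam * M) = √lam * √M := sqrt_mul hlam0.le M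
    have hsl : 1 ≤ √lam := one_le_sqrt.2 h1
    have hsl2 : √lam * √lam = lam := mul_self_sqrt hlam0.le
    have hE : ((T + log lam) * √(lam * M) + 2 + 2 * J) ≤
        √lam * (1 + log lam) * ((T + 1) * √M + 4 + 2 * K) := by
      have e1 : (T + log lam) * √(lam * M) ≤ √lam * (1 + log lam) * ((T + 1) * √M) := by
        rw [hsq]
        have : T + log lam ≤ (1 + log lam) * (T + 1) := by nlinarith
        calc (T + log lam) * (√lam * √M) ≤ ((1 + log lam) * (T + 1)) * (√lam * √M) := by gcongr
          _ = _ := by ring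
      have e2 : 4 + 2 * (K * log lam) ≤ √lam * (1 + log lam) * (4 + 2 * K) := by
        have : 1 + log lam ≤ √lam * (1 + log lam) := le_mul_of_one_le_left (by linarith) hsl
        calc 4 + 2 * (K * log lam) ≤ (1 + log lam) * (4 + 2 * K) := by nlinarith
          _ ≤ _ := by gcongr
      linarith
    have hFc : (F.card : ℝ) ≤ √lam * (2 * |Φ| + 2 * √M + 5) := by
      rw [hFcard]
      have : 2 * |Φ| + 5 ≤ √lam * (2 * |Φ| + 5) := le_mul_of_one_le_left (by positivity) hsl
      linarith
    calc ∑ n ∈ F, ((S n).card : ℝ) ≤ ∑ n ∈ F, (c * σ ^ (p + 1) * lam ^ p *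
          |(n : ℝ) - Φ| ^ (1 - 2 * p) + √lam * (1 + log lam) * ((T + 1) * √M + 4 + 2 * K)) :=
          Finset.sum_le_sum fun n _ => (hcard n).trans (by gcongr)
      _ = c * σ ^ (p + 1) * lam ^ p * (∑ n ∈ F, |(n : ℝ) - Φ| ^ (1 - 2 * p)) +
          F.card * (√lam * (1 + log lam) * ((T + 1) * √M + 4 + 2 * K)) := by
          rw [Finset.sum_add_distrib, ← Finset.mul_sum, Finset.sum_const, nsmul_eq_mul]
      _ ≤ c * σ ^ (p + 1) * lam ^ p * (∑' n : ℤ, |(n : ℝ) - Φ| ^ (1 - 2 * p)) +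
          √lam * (2 * |Φ| + 2 * √M + 5) *
            (√lam * (1 + log lam) * ((T + 1) * √M + 4 + 2 * K)) := by
          have := (summable_abs_int_sub_rpow Φ hp).sum_le_tsum F
            fun n _ => rpow_nonneg (abs_nonneg _) _
          gcongr
      _ = _ := by
          rw [show √lam * (2 * |Φ| + 2 * √M + 5) *
            (√lam * (1 + log lam) * ((T + 1) * √M + 4 + 2 * K)) = (√lam * √lam) *
            ((2 * |Φ| + 2 * √M + 5) * ((1 + log lam) * ((T + 1) * √M + 4 + 2 * K))) by ring, hsl2]
          ring
  · intro n hn t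
    refine (hmajlam t).trans ?_
    have h4 : √(lam * M) ≤ |(n : ℝ) - Φ| := by
      have h5 : (N : ℝ) ≤ |(n : ℝ)| := by
        have : (N : ℤ) < |n| := by
          rw [hF, Finset.mem_Icc, ← abs_le] at hn
          exact not_le.1 hn
        exact_mod_cast this.le
      have h6 := abs_sub_abs_le_abs_sub (n : ℝ) Φ
      linarith
    rw [← sq_sqrt (show 0 ≤ lam * M by positivity), ← sq_abs ((n : ℝ) - Φ)]
    gcongr

/-- A smooth function vanishing near `(-∞, 0]` which is close to the identity on `[0, ∞)`. -/
lemma exists_smooth_truncation {δ : ℝ} (hδ : 0 < δ) :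
    ∃ h : ℝ → ℝ, ContDiff ℝ (⊤ : ℕ∞) h ∧ (∀ s ≤ δ, h s = 0) ∧ (∀ s, s - 2 * δ ≤ h s) ∧
      ∀ s, |deriv h s| ≤ 1 := by
  set k : ℝ → ℝ := fun x => smoothTransition (x / δ - 1) with hk
  have hkc : ContDiff ℝ (⊤ : ℕ∞) k := by
    refine smoothTransition.contDiff.comp ?_
    fun_prop
  have hk0 : ∀ x, 0 ≤ k x := fun x => smoothTransition.nonneg _
  have hk1 : ∀ x, k x ≤ 1 := fun x => smoothTransition.le_one _
  have hkz : ∀ x ≤ δ, k x = 0 := fun x hx => smoothTransition.zero_of_nonpos (by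
    rw [sub_nonpos, div_le_one hδ]; exact hx)
  have hko : ∀ x, 2 * δ ≤ x → k x = 1 := fun x hx => smoothTransition.one_of_one_le (by
    rw [le_sub_iff_add_le, le_div_iff₀ hδ]; linarith)
  have hki : ∀ a b, IntervalIntegrable k volume a b := fun a b =>
    hkc.continuous.intervalIntegrable a b
  have hd : ∀ s, HasDerivAt (fun s => ∫ x in (δ)..s, k x) (k s) s := fun s =>
    intervalIntegral.integral_hasDerivAt_right (hki _ _)
      (hkc.continuous.stronglyMeasurableAtFilter _ _) hkc.continuous.continuousAt
  have hd' : deriv (fun s => ∫ x in (δ)..s, k x) = k := funext fun s => (hd s).deriv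
  have hnn : ∀ s, 0 ≤ ∫ x in (δ)..s, k x := by
    intro s
    rcases le_total δ s with h | h
    · exact intervalIntegral.integral_nonneg h fun x _ => hk0 x
    · rw [intervalIntegral.integral_symm, intervalIntegral.integral_congr
        (g := fun _ => 0) fun x hx => hkz x (by rw [uIcc_of_le h] at hx; exact hx.2)]
      simp
  refine ⟨fun s => ∫ x in (δ)..s, k x, ?_, ?_, ?_, ?_⟩
  · rw [contDiff_infty_iff_deriv, hd']
    exact ⟨fun s => (hd s).differentiableAt, hkc⟩
  · intro s h
    simp only
    rw [intervalIntegral.integral_symm, intervalIntegral.integral_congr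
        (g := fun _ => 0) fun x hx => hkz x (by rw [uIcc_of_le h] at hx; exact hx.2)]
    simp
  · intro s
    rcases le_total (2 * δ) s with h | h
    · simp only
      rw [← intervalIntegral.integral_add_adjacent_intervals (hki δ (2 * δ)) (hki (2 * δ) s),
        intervalIntegral.integral_congr (a := 2 * δ) (g := fun _ => (1 : ℝ))
          fun x hx => hko x (by rw [uIcc_of_le h] at hx; exact hx.1)]
      have := hnn (2 * δ)
      simp only [intervalIntegral.integral_const, smul_eq_mul, mul_one]
      linarith
    · exact le_trans (by linarith) (hnn s)
  · intro s
    rw [hd', abs_of_nonneg (hk0 s)]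
    exact hk1 s

/-- A smooth function supported in `(0, π)` almost optimizing the Wirtinger inequality. -/
lemma exists_wirtinger_profile {σ : ℝ} (hσ : 1 < σ) :
    ∃ f : ℝ → ℝ, ContDiff ℝ (⊤ : ℕ∞) f ∧ (∀ t ∉ Ioo 0 π, f t = 0 ∧ deriv f t = 0) ∧
      ∫ t, deriv f t ^ 2 < σ * ∫ t, f t ^ 2 := by
  set δ := π * (σ - 1) / (32 * σ) with hδdef
  have hδ : 0 < δ := by
    have := pi_pos
    have : 0 < σ - 1 := by linarith
    positivity
  obtain ⟨h, hh, h0, hlow, hder⟩ := exists_smooth_truncation hδ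
  set f : ℝ → ℝ := fun t => if t ∈ Ioo 0 π then h (sin t) else 0 with hf
  have hin : ∀ t ∈ Ioo 0 π, f =ᶠ[nhds t] fun t => h (sin t) := fun t ht => by
    filter_upwards [isOpen_Ioo.mem_nhds ht] with s hs
    exact if_pos hs
  have hout : ∀ t ∉ Ioo 0 π, f =ᶠ[nhds t] fun _ => 0 := by
    intro t ht
    have h1 : ∀ᶠ s in nhds t, s ∈ Ioo 0 π → sin s < δ := by
      rcases lt_trichotomy t 0 with h2 | h2 | h2
      · filter_upwards [Iio_mem_nhds h2] with s hs hs'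
        exact absurd hs'.1 (not_lt.2 (le_of_lt hs))
      · have : sin t < δ := by rw [h2, sin_zero]; exact hδ
        filter_upwards [continuous_sin.continuousAt.eventually_lt_const this] with s hs _ using hs
      · have h3 : π ≤ t := by
          by_contra! h4
          exact ht ⟨h2, h4⟩
        rcases h3.eq_or_lt with h4 | h4
        · have : sin t < δ := by rw [← h4, sin_pi]; exact hδ
          filter_upwards [continuous_sin.continuousAt.eventually_lt_const this] with s hs _ using hs
        · filter_upwards [Ioi_mem_nhds h4] with s hs hs'
          exact absurd hs'.2 (not_lt.2 (le_of_lt hs))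
    filter_upwards [h1] with s hs
    simp only [hf]
    split_ifs with h2
    · exact h0 _ (hs h2).le
    · rfl
  have hfs : ContDiff ℝ (⊤ : ℕ∞) f := by
    rw [contDiff_iff_contDiffAt]
    intro t
    by_cases ht : t ∈ Ioo 0 π
    · exact ((hh.comp contDiff_sin).contDiffAt).congr_of_eventuallyEq (hin t ht)
    · exact contDiffAt_const.congr_of_eventuallyEq (hout t ht)
  have hzero : ∀ t ∉ Ioo 0 π, f t = 0 ∧ deriv f t = 0 := fun t ht =>
    ⟨(hout t ht).eq_of_nhds, by rw [(hout t ht).deriv_eq]; simp⟩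
  have hf'c : Continuous (deriv f) := hfs.continuous_deriv (by simp)
  refine ⟨f, hfs, hzero, ?_⟩
  have hset : ∀ k : ℝ → ℝ, (∀ t ∉ Ioo 0 π, k t = 0) → ∫ t, k t = ∫ t in (0 : ℝ)..π, k t := by
    intro k hk
    rw [intervalIntegral.integral_of_le pi_pos.le]
    refine (setIntegral_eq_integral_of_forall_compl_eq_zero fun t ht => hk t fun h => ?_).symm
    exact ht ⟨h.1, h.2.le⟩
  rw [hset _ fun t ht => by rw [(hzero t ht).2]; simp,
    hset _ fun t ht => by rw [(hzero t ht).1]; simp]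
  have h1 : ∫ t in (0 : ℝ)..π, deriv f t ^ 2 ≤ ∫ t in (0 : ℝ)..π, cos t ^ 2 := by
    refine intervalIntegral.integral_mono_on pi_pos.le
      ((hf'c.pow 2).intervalIntegrable _ _) ((continuous_cos.pow 2).intervalIntegrable _ _) ?_
    intro t _
    by_cases ht : t ∈ Ioo 0 π
    · have hd : HasDerivAt (fun t => h (sin t)) (deriv h (sin t) * cos t) t :=
        ((hh.differentiable (by simp)) (sin t)).hasDerivAt.comp t (hasDerivAt_sin t)
      rw [(hin t ht).deriv_eq, hd.deriv, mul_pow]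
      have := (sq_le_one_iff_abs_le_one _).2 (hder (sin t))
      exact mul_le_of_le_one_left (sq_nonneg _) this
    · rw [(hzero t ht).2]
      simp only [ne_eq, OfNat.ofNat_ne_zero, not_false_eq_true, zero_pow]
      positivity
  have h2 : ∫ t in (0 : ℝ)..π, (sin t ^ 2 - 4 * δ * sin t) ≤ ∫ t in (0 : ℝ)..π, f t ^ 2 := by
    refine intervalIntegral.integral_mono_on_of_le_Ioo pi_pos.le
      (Continuous.intervalIntegrable (by fun_prop) _ _)
      ((hfs.continuous.pow 2).intervalIntegrable _ _) ?_
    intro t ht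
    have h3 : f t = h (sin t) := if_pos ht
    have h4 := sin_pos_of_mem_Ioo ht
    have h5 := hlow (sin t)
    rw [h3]
    rcases le_total (2 * δ) (sin t) with h6 | h6
    · nlinarith
    · nlinarith [sq_nonneg (h (sin t))]
  rw [integral_cos_sq] at h1
  rw [intervalIntegral.integral_sub (Continuous.intervalIntegrable (by fun_prop) _ _)
    (Continuous.intervalIntegrable (by fun_prop) _ _), intervalIntegral.integral_const_mul,
    integral_sin_sq, integral_sin] at h2
  simp only [cos_pi, sin_pi, cos_zero, sin_zero, mul_zero, zero_mul] at h1 h2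
  have h3 : σ * (8 * δ) = π * (σ - 1) / 4 := by
    rw [hδdef]; field_simp; ring
  have h4 : 0 < π * (σ - 1) := mul_pos pi_pos (by linarith)
  nlinarith

/-- A smooth trial function on `(α, β)` for a one-dimensional Schrödinger form. -/
lemma exists_trial_function {σ : ℝ} (hσ : 1 < σ) {α β w A : ℝ} (hαβ : α < β)
    (hw : π ^ 2 * σ ≤ (w - A) * (β - α) ^ 2) :
    ∃ φ : ℝ → ℝ, ContDiff ℝ (⊤ : ℕ∞) φ ∧ (∀ t ∉ Ioo α β, φ t = 0 ∧ deriv φ t = 0) ∧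
      (∫ t, deriv φ t ^ 2) + A * ∫ t, φ t ^ 2 < w * ∫ t, φ t ^ 2 := by
  obtain ⟨f, hf, hf0, hlt⟩ := exists_wirtinger_profile hσ
  have hl : 0 < β - α := sub_pos.2 hαβ
  set r := π / (β - α) with hr
  have hr0 : 0 < r := div_pos pi_pos hl
  have hd : ∀ t, HasDerivAt (fun t => f (r * (t - α))) (r * deriv f (r * (t - α))) t := by
    intro t
    have h1 : HasDerivAt (fun t => r * (t - α)) r t := by
      simpa using ((hasDerivAt_id t).sub_const α).const_mul r
    have h2 := ((hf.differentiable (by simp)) (r * (t - α))).hasDerivAt.comp t h1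
    rw [mul_comm]
    exact h2
  have hd' : deriv (fun t => f (r * (t - α))) = fun t => r * deriv f (r * (t - α)) :=
    funext fun t => (hd t).deriv
  have hcv : ∀ k : ℝ → ℝ, ∫ t, k (r * (t - α)) = r⁻¹ * ∫ t, k t := by
    intro k
    rw [integral_sub_right_eq_self (fun t => k (r * t)) α, Measure.integral_comp_mul_left,
      abs_of_pos (inv_pos.2 hr0), smul_eq_mul]
  refine ⟨fun t => f (r * (t - α)), by fun_prop, ?_, ?_⟩
  · intro t ht
    have h1 : r * (t - α) ∉ Ioo 0 π := by
      rintro ⟨h2, h3⟩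
      refine ht ⟨by have := (mul_pos_iff_of_pos_left hr0).1 h2; linarith, ?_⟩
      rw [hr, div_mul_eq_mul_div, div_lt_iff₀ hl] at h3
      have := lt_of_mul_lt_mul_left h3 pi_pos.le
      linarith
    rw [hd']
    exact ⟨(hf0 _ h1).1, by simp only [(hf0 _ h1).2, mul_zero]⟩
  · rw [hd']
    simp only [mul_pow]
    rw [integral_const_mul, hcv (fun t => deriv f t ^ 2), hcv (fun t => f t ^ 2)]
    have h1 : r ^ 2 * σ ≤ w - A := by
      rw [hr, div_pow, div_mul_eq_mul_div, div_le_iff₀ (by positivity)]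
      exact hw
    have h2 : 0 ≤ ∫ t, f t ^ 2 := integral_nonneg fun t => sq_nonneg _
    have h3 : r ^ 2 * ∫ t, deriv f t ^ 2 < r ^ 2 * (σ * ∫ t, f t ^ 2) := by gcongr
    have h4 : r ^ 2 * σ * ∫ t, f t ^ 2 ≤ (w - A) * ∫ t, f t ^ 2 := by gcongr
    have h5 : r⁻¹ * (r ^ 2 * ∫ t, deriv f t ^ 2) < r⁻¹ * ((w - A) * ∫ t, f t ^ 2) := by
      exact mul_lt_mul_of_pos_left (by linarith) (inv_pos.2 hr0)
    linarith

/-- The function with radial profile `φ` in the logarithmic radius and angular momentum `n`. -/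
noncomputable def modeFun (n : ℤ) (φ : ℝ → ℝ) (x : ℝ × ℝ) : ℂ :=
  (φ (log (sqnorm x) / 2) : ℂ) * (((x.1 : ℂ) + x.2 * Complex.I) / (√(sqnorm x) : ℝ)) ^ n

lemma modeFun_logPolar (n : ℤ) (φ : ℝ → ℝ) (q : ℝ × ℝ) :
    modeFun n φ (logPolar q) = φ q.1 * Complex.exp (n * q.2 * Complex.I) := by
  have h1 : √(exp (2 * q.1)) = exp q.1 := by
    rw [two_mul, exp_add]
    exact sqrt_mul_self (exp_pos _).le
  have h2 : (((logPolar q).1 : ℂ) + (logPolar q).2 * Complex.I) / (exp q.1 : ℝ) =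
      Complex.exp (q.2 * Complex.I) := by
    have : ((exp q.1 : ℝ) : ℂ) ≠ 0 := by exact_mod_cast (exp_pos q.1).ne'
    rw [div_eq_iff this, Complex.exp_mul_I, logPolar]
    push_cast
    ring
  rw [modeFun, sqnorm_logPolar, log_exp, h1, h2, ← Complex.exp_int_mul]
  congr 2
  · congr 1
    ring
  · ring

lemma contDiffAt_zpow_of_ne_zero {f : ℝ × ℝ → ℂ} {x : ℝ × ℝ} (hf : ContDiffAt ℝ (⊤ : ℕ∞) f x)
    (hx : f x ≠ 0) (n : ℤ) : ContDiffAt ℝ (⊤ : ℕ∞) (fun y => f y ^ n) x := by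
  cases n with
  | ofNat k => simpa using hf.pow k
  | negSucc k =>
    simp only [zpow_negSucc]
    exact (hf.pow (k + 1)).inv (pow_ne_zero _ hx)

lemma isTestFun_modeFun (n : ℤ) {φ : ℝ → ℝ} (hφ : ContDiff ℝ (⊤ : ℕ∞) φ) {α β : ℝ} (hα : 1 ≤ α)
    (h0 : ∀ t ∉ Ioo α β, φ t = 0) : IsTestFun (modeFun n φ) := by
  have hnn : ∀ x : ℝ × ℝ, 0 ≤ sqnorm x := fun x => by unfold sqnorm; positivity
  have hsmall : ∀ x : ℝ × ℝ, sqnorm x < exp 1 → modeFun n φ x = 0 := by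
    intro x hx
    have h1 : log (sqnorm x) / 2 < 1 := by
      rcases (hnn x).eq_or_lt with h | h
      · rw [← h]; norm_num
      · have := (log_lt_iff_lt_exp h).2 hx
        linarith
    rw [modeFun, h0 _ fun h => by linarith [h.1]]
    simp
  have hev : ∀ x : ℝ × ℝ, sqnorm x < exp 1 → modeFun n φ =ᶠ[nhds x] fun _ => 0 := by
    intro x hx
    filter_upwards [continuous_sqnorm.continuousAt.eventually_lt_const hx] with y hy
      using hsmall y hy
  refine ⟨?_, ?_, ?_⟩
  · rw [contDiff_iff_contDiffAt]
    intro x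
    rcases lt_or_ge (sqnorm x) (exp 1) with hx | hx
    · exact contDiffAt_const.congr_of_eventuallyEq (hev x hx)
    · have hs : 0 < sqnorm x := (exp_pos 1).trans_le hx
      have hsq : ContDiff ℝ (⊤ : ℕ∞) sqnorm := by unfold sqnorm; fun_prop
      have hofReal : ContDiff ℝ (⊤ : ℕ∞) (fun y : ℝ => (y : ℂ)) := Complex.ofRealCLM.contDiff
      have hrad : ContDiffAt ℝ (⊤ : ℕ∞) (fun y : ℝ × ℝ => ((φ (log (sqnorm y) / 2) : ℝ) : ℂ)) x := by
        refine hofReal.contDiffAt.comp x (hφ.contDiffAt.comp x ?_)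
        exact (hsq.contDiffAt.log hs.ne').div_const 2
      refine hrad.mul (contDiffAt_zpow_of_ne_zero ?_ ?_ n)
      · simp only [div_eq_mul_inv]
        refine ContDiffAt.mul ?_ (ContDiffAt.inv ?_ ?_)
        · refine ContDiff.contDiffAt ?_
          exact (hofReal.comp contDiff_fst).add ((hofReal.comp contDiff_snd).mul contDiff_const)
        · exact hofReal.contDiffAt.comp x (hsq.contDiffAt.sqrt hs.ne')
        · exact_mod_cast (sqrt_pos.2 hs).ne'
      · refine div_ne_zero ?_ ?_
        · intro h
          have h1 := congrArg Complex.re h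
          have h2 := congrArg Complex.im h
          simp at h1 h2
          rw [sqnorm, h1, h2] at hs
          norm_num at hs
        · exact_mod_cast (sqrt_pos.2 hs).ne'
  · refine HasCompactSupport.intro (isCompact_closedBall (0 : ℝ × ℝ) (exp β)) fun x hx => ?_
    rw [mem_closedBall_zero_iff, not_le] at hx
    have h1 : exp β ^ 2 < sqnorm x := by
      unfold sqnorm
      rw [Prod.norm_def, lt_max_iff] at hx
      rcases hx with hx | hx
      · have : exp β ^ 2 < ‖x.1‖ ^ 2 := by gcongr
        rw [norm_eq_abs, sq_abs] at this
        nlinarith [sq_nonneg x.2]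
      · have : exp β ^ 2 < ‖x.2‖ ^ 2 := by gcongr
        rw [norm_eq_abs, sq_abs] at this
        nlinarith [sq_nonneg x.1]
    have h2 : β < log (sqnorm x) / 2 := by
      have h3 := log_lt_log (by positivity) h1
      rw [log_pow, log_exp] at h3
      push_cast at h3
      linarith
    rw [modeFun, h0 _ fun h => by linarith [h.2]]
    simp
  · refine hev 0 ?_
    simp [sqnorm, exp_pos]

lemma integral_exp_int_mul_I (m : ℤ) :
    ∫ θ in (-π)..π, Complex.exp (m * θ * Complex.I) = if m = 0 then (2 * π : ℂ) else 0 := by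
  split_ifs with h
  · simp [h]
    ring
  · have hc : (m : ℂ) * Complex.I ≠ 0 := by simp [h]
    have h1 : ∀ θ : ℝ, Complex.exp (m * θ * Complex.I) = Complex.exp (m * Complex.I * θ) :=
      fun θ => by ring_nf
    simp only [h1]
    rw [integral_exp_mul_complex hc]
    have h2 : Complex.exp (m * Complex.I * (π : ℝ)) =
        Complex.exp (m * Complex.I * ((-π : ℝ) : ℂ)) := by
      rw [Complex.exp_eq_exp_iff_exists_int]
      exact ⟨m, by push_cast; ring⟩
    rw [h2, sub_self, zero_div]

/-- Orthogonality of the angular modes. -/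
lemma integral_norm_sq_sum_modes {ι : Type*} [Fintype ι] (n : ι → ℤ) (c : ι → ℂ)
    (hc : ∀ k l, k ≠ l → n k = n l → c k * c l = 0) :
    ∫ θ in (-π)..π, ‖∑ k, c k * Complex.exp (n k * θ * Complex.I)‖ ^ 2 =
      2 * π * ∑ k, ‖c k‖ ^ 2 := by
  have h1 : ∀ θ : ℝ, ((‖∑ k, c k * Complex.exp (n k * θ * Complex.I)‖ ^ 2 : ℝ) : ℂ) =
      ∑ k, ∑ l, c k * (starRingEnd ℂ) (c l) *
        Complex.exp ((n k - n l : ℤ) * θ * Complex.I) := by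
    intro θ
    rw [Complex.ofReal_pow, ← Complex.mul_conj', map_sum, Finset.sum_mul_sum]
    refine Finset.sum_congr rfl fun k _ => Finset.sum_congr rfl fun l _ => ?_
    have h2 : Complex.exp ((n k - n l : ℤ) * θ * Complex.I) =
        Complex.exp (n k * θ * Complex.I) *
          (starRingEnd ℂ) (Complex.exp (n l * θ * Complex.I)) := by
      rw [← Complex.exp_conj, ← Complex.exp_add]
      congr 1
      simp only [map_mul, Complex.conj_I, Complex.conj_ofReal, map_intCast]
      push_cast
      ring
    rw [h2, map_mul]
    ring
  rw [← Complex.ofReal_inj, ← intervalIntegral.integral_ofReal]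
  simp only [h1]
  rw [intervalIntegral.integral_finsetSum fun k _ =>
    Continuous.intervalIntegrable (by fun_prop) _ _]
  simp only [Complex.ofReal_mul, Complex.ofReal_sum, Complex.ofReal_pow, Complex.ofReal_ofNat]
  rw [Finset.mul_sum]
  refine Finset.sum_congr rfl fun k _ => ?_
  rw [intervalIntegral.integral_finsetSum fun l _ =>
    Continuous.intervalIntegrable (by fun_prop) _ _]
  rw [Finset.sum_eq_single k]
  · rw [intervalIntegral.integral_const_mul, sub_self, integral_exp_int_mul_I, if_pos rfl,
      Complex.mul_conj']
    ring
  · intro l _ hl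
    rw [intervalIntegral.integral_const_mul, integral_exp_int_mul_I]
    split_ifs with h
    · have h3 := hc k l hl.symm (sub_eq_zero.1 h)
      rcases mul_eq_zero.1 h3 with h4 | h4 <;> simp [h4]
    · simp
  · simp

lemma IsTestFun.zero : IsTestFun 0 :=
  ⟨contDiff_const, HasCompactSupport.zero, Filter.Eventually.of_forall fun _ => rfl⟩

lemma IsTestFun.add {u v : ℝ × ℝ → ℂ} (hu : IsTestFun u) (hv : IsTestFun v) :
    IsTestFun (u + v) := by
  refine ⟨hu.1.add hv.1, hu.2.1.add hv.2.1, ?_⟩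
  filter_upwards [hu.2.2, hv.2.2] with x h1 h2
  simp [h1, h2]

lemma IsTestFun.const_smul {u : ℝ × ℝ → ℂ} (hu : IsTestFun u) (c : ℂ) : IsTestFun (c • u) := by
  refine ⟨contDiff_const.smul hu.1, hu.2.1.smul_left (f := fun _ => c), ?_⟩
  filter_upwards [hu.2.2] with x h1
  simp [h1]

/-- A finite linear combination of angular modes. -/
noncomputable def modeSum {ι : Type*} [Fintype ι] (n : ι → ℤ) (φ : ι → ℝ → ℝ) :
    (ι → ℂ) →ₗ[ℂ] (ℝ × ℝ → ℂ) where
  toFun b := ∑ k, b k • modeFun (n k) (φ k)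
  map_add' b c := by simp [add_smul, Finset.sum_add_distrib]
  map_smul' r b := by simp [Finset.smul_sum, mul_smul]

lemma mul_eq_zero_of_disjoint {ι : Type*} {n : ι → ℤ} {α β : ι → ℝ} {ψ : ι → ℝ → ℝ} (hψ : ∀ k, ∀ t ∉ Ioo (α k) (β k), ψ k t = 0)
    (hdis : ∀ k l, k ≠ l → n k = n l → Disjoint (Ioo (α k) (β k)) (Ioo (α l) (β l)))
    (b : ι → ℂ) (t : ℝ) {k l : ι} (hkl : k ≠ l) (hn : n k = n l) :
    b k * ψ k t * (b l * ψ l t) = 0 := by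
  by_cases h : t ∈ Ioo (α k) (β k)
  · rw [hψ l t (disjoint_left.1 (hdis k l hkl hn) h)]
    simp
  · rw [hψ k t h]
    simp

section ModeSum

variable {ι : Type*} [Fintype ι] {n : ι → ℤ} {φ : ι → ℝ → ℝ} {α β : ι → ℝ}

lemma isTestFun_modeSum (hφ : ∀ k, ContDiff ℝ (⊤ : ℕ∞) (φ k)) (hα : ∀ k, 1 ≤ α k)
    (h0 : ∀ k, ∀ t ∉ Ioo (α k) (β k), φ k t = 0 ∧ deriv (φ k) t = 0) (b : ι → ℂ) :
    IsTestFun (modeSum n φ b) :=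
  Finset.sum_induction _ IsTestFun (fun _ _ => IsTestFun.add) IsTestFun.zero fun k _ =>
    (isTestFun_modeFun (n k) (hφ k) (hα k) fun t ht => (h0 k t ht).1).const_smul (b k)

lemma modeSum_logPolar (b : ι → ℂ) (q : ℝ × ℝ) : modeSum n φ b (logPolar q) =
    ∑ k, b k * φ k q.1 * Complex.exp (n k * q.2 * Complex.I) := by
  change (∑ k, b k • modeFun (n k) (φ k)) (logPolar q) = _
  rw [Finset.sum_apply]
  refine Finset.sum_congr rfl fun k _ => ?_
  rw [Pi.smul_apply, modeFun_logPolar, smul_eq_mul]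
  ring

lemma integral_sum_norm_sq_mul {ω : ℝ → ℝ} (hω : Measurable ω)
    (hB : ∀ R, ∃ B, ∀ t, |t| ≤ R → |ω t| ≤ B) {ψ : ι → ℝ → ℝ} (hψc : ∀ k, Continuous (ψ k))
    (hψ : ∀ k, ∀ t ∉ Ioo (α k) (β k), ψ k t = 0) (b : ι → ℂ) :
    Integrable (fun t => ω t * (2 * π * ∑ k, ‖b k * ψ k t‖ ^ 2)) ∧
    ∫ t, ω t * (2 * π * ∑ k, ‖b k * ψ k t‖ ^ 2) =
      2 * π * ∑ k, ‖b k‖ ^ 2 * ∫ t, ω t * ψ k t ^ 2 := by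
  have hint : ∀ k, Integrable fun t => ω t * ψ k t ^ 2 := by
    intro k
    refine integrable_mul_of_eq_zero hω hB ((hψc k).pow 2) (R := max |α k| |β k|) fun t ht => ?_
    rw [hψ k t, zero_pow two_ne_zero]
    rintro ⟨h1, h2⟩
    rw [max_lt_iff] at ht
    rcases le_total 0 t with h | h
    · rw [abs_of_nonneg h] at ht
      linarith [le_abs_self (β k)]
    · rw [abs_of_nonpos h] at ht
      linarith [neg_abs_le (α k)]
  have heq : (fun t => ω t * (2 * π * ∑ k, ‖b k * ψ k t‖ ^ 2)) =
      fun t => 2 * π * ∑ k, ‖b k‖ ^ 2 * (ω t * ψ k t ^ 2) := by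
    ext t
    rw [mul_left_comm, Finset.mul_sum]
    congr 1
    refine Finset.sum_congr rfl fun k _ => ?_
    rw [norm_mul, mul_pow, Complex.norm_real, norm_eq_abs, sq_abs]
    ring
  rw [heq]
  have hint2 : ∀ k ∈ Finset.univ, Integrable fun t => ‖b k‖ ^ 2 * (ω t * ψ k t ^ 2) :=
    fun k _ => (hint k).const_mul _
  refine ⟨(integrable_finsetSum _ hint2).const_mul _, ?_⟩
  rw [integral_const_mul, integral_finsetSum _ hint2]
  simp only [integral_const_mul]

lemma integral_radialPotential_modeSum (hφ : ∀ k, ContDiff ℝ (⊤ : ℕ∞) (φ k)) (hα : ∀ k, 1 ≤ α k)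
    (h0 : ∀ k, ∀ t ∉ Ioo (α k) (β k), φ k t = 0 ∧ deriv (φ k) t = 0)
    (hdis : ∀ k l, k ≠ l → n k = n l → Disjoint (Ioo (α k) (β k)) (Ioo (α l) (β l)))
    {ω : ℝ → ℝ} (hω : Measurable ω) (hB : ∀ R, ∃ B, ∀ t, |t| ≤ R → |ω t| ≤ B) (b : ι → ℂ) :
    ∫ x, radialPotential ω x * ‖modeSum n φ b x‖ ^ 2 =
      2 * π * ∑ k, ‖b k‖ ^ 2 * ∫ t, ω t * φ k t ^ 2 := by
  rw [integral_radialPotential (isTestFun_modeSum hφ hα h0 b) hω hB,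
    ← (integral_sum_norm_sq_mul hω hB (fun k => (hφ k).continuous)
      (fun k t ht => (h0 k t ht).1) b).2]
  congr 1
  ext t
  simp only [Function.comp_apply, modeSum_logPolar]
  rw [integral_norm_sq_sum_modes n (fun k => b k * φ k t) fun k l hkl hn =>
    mul_eq_zero_of_disjoint (fun k t ht => (h0 k t ht).1) hdis b t hkl hn]

lemma magEnergy_modeSum (Φ : ℝ) (hφ : ∀ k, ContDiff ℝ (⊤ : ℕ∞) (φ k)) (hα : ∀ k, 1 ≤ α k)
    (h0 : ∀ k, ∀ t ∉ Ioo (α k) (β k), φ k t = 0 ∧ deriv (φ k) t = 0)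
    (hdis : ∀ k l, k ≠ l → n k = n l → Disjoint (Ioo (α k) (β k)) (Ioo (α l) (β l)))
    (b : ι → ℂ) :
    magEnergy Φ (modeSum n φ b) = 2 * π * ∑ k, ‖b k‖ ^ 2 *
      ((∫ t, deriv (φ k) t ^ 2) + (n k - Φ) ^ 2 * ∫ t, φ k t ^ 2) := by
  have hu := isTestFun_modeSum (n := n) hφ hα h0 b
  have hU := hu.contDiff_comp_logPolar
  have hφ' : ∀ k, Continuous (deriv (φ k)) := fun k => (hφ k).continuous_deriv (by simp)
  have hd1 : ∀ t θ, fderiv ℝ (modeSum n φ b ∘ logPolar) (t, θ) (1, 0) =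
      ∑ k, b k * deriv (φ k) t * Complex.exp (n k * θ * Complex.I) := by
    intro t θ
    refine (hasDerivAt_fst_slice hU t θ).unique ?_
    simp only [Function.comp_apply, modeSum_logPolar]
    refine HasDerivAt.fun_sum fun k _ => ?_
    exact ((((hφ k).differentiable (by simp) t).hasDerivAt.ofReal_comp).const_mul _).mul_const _
  have hd2 : ∀ t θ, fderiv ℝ (modeSum n φ b ∘ logPolar) (t, θ) (0, 1) =
      ∑ k, b k * φ k t * (Complex.exp (n k * θ * Complex.I) * (n k * Complex.I)) := by
    intro t θ
    refine (hasDerivAt_snd_slice hU t θ).unique ?_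
    simp only [Function.comp_apply, modeSum_logPolar]
    refine HasDerivAt.fun_sum fun k _ => HasDerivAt.const_mul _ ?_
    have h1 : HasDerivAt (fun θ : ℝ => (n k : ℂ) * θ * Complex.I) (n k * Complex.I) θ := by
      simpa using ((Complex.ofRealCLM.hasDerivAt (x := θ)).const_mul (n k : ℂ)).mul_const Complex.I
    exact h1.cexp
  have hd3 : ∀ t θ, -Complex.I * fderiv ℝ (modeSum n φ b ∘ logPolar) (t, θ) (0, 1) -
      Φ * (modeSum n φ b ∘ logPolar) (t, θ) =
      ∑ k, b k * (((n k - Φ) * φ k t : ℝ) : ℂ) * Complex.exp (n k * θ * Complex.I) := by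
    intro t θ
    rw [hd2, Function.comp_apply, modeSum_logPolar, Finset.mul_sum, Finset.mul_sum,
      ← Finset.sum_sub_distrib]
    refine Finset.sum_congr rfl fun k _ => ?_
    push_cast
    linear_combination (-(b k * φ k t * Complex.exp (n k * θ * Complex.I) * n k)) * Complex.I_mul_I
  have hz1 : ∀ k, ∀ t ∉ Ioo (α k) (β k), deriv (φ k) t = 0 := fun k t ht => (h0 k t ht).2
  have hz2 : ∀ k, ∀ t ∉ Ioo (α k) (β k), (n k - Φ) * φ k t = 0 := fun k t ht => by
    rw [(h0 k t ht).1, mul_zero]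
  have hc2 : ∀ k, Continuous fun t => (n k - Φ) * φ k t := fun k =>
    continuous_const.mul (hφ k).continuous
  have hone : ∀ R : ℝ, ∃ B : ℝ, ∀ t : ℝ, |t| ≤ R → |(1 : ℝ)| ≤ B := fun R => ⟨1, by simp⟩
  obtain ⟨hi1, he1⟩ := integral_sum_norm_sq_mul (ω := fun _ => 1) measurable_const hone hφ' hz1 b
  obtain ⟨hi2, he2⟩ := integral_sum_norm_sq_mul (ω := fun _ => 1) measurable_const hone hc2 hz2 b
  simp only [one_mul] at hi1 he1 hi2 he2
  rw [magEnergy_eq_integral_cylinder Φ hu]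
  have hθ : ∀ t, ∫ θ in (-π)..π, cylinderDensity Φ (modeSum n φ b ∘ logPolar) (t, θ) =
      2 * π * (∑ k, ‖b k * deriv (φ k) t‖ ^ 2) +
        2 * π * ∑ k, ‖b k * (((n k - Φ) * φ k t : ℝ) : ℂ)‖ ^ 2 := by
    intro t
    simp only [cylinderDensity, hd1, hd3]
    rw [intervalIntegral.integral_add (Continuous.intervalIntegrable (by fun_prop) _ _)
      (Continuous.intervalIntegrable (by fun_prop) _ _),
      integral_norm_sq_sum_modes n (fun k => b k * (deriv (φ k) t : ℝ)) fun k l hkl hn =>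
        mul_eq_zero_of_disjoint hz1 hdis b t hkl hn,
      integral_norm_sq_sum_modes n (fun k => b k * (((n k - Φ) * φ k t : ℝ) : ℂ))
        fun k l hkl hn => mul_eq_zero_of_disjoint hz2 hdis b t hkl hn]
  simp only [hθ]
  rw [integral_add hi1 hi2, he1, he2, ← mul_add, ← Finset.sum_add_distrib]
  congr 1
  refine Finset.sum_congr rfl fun k _ => ?_
  simp only [mul_pow, integral_const_mul]
  ring

/-- A finite family of one-dimensional trial functions, disjointly supported in each angular
channel, yields a lower bound for the number of negative eigenvalues. -/
lemma card_le_negEigCount (Φ : ℝ) {W : ℝ × ℝ → ℝ} (hW : Measurable W)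
    (hWb : ∃ B, ∀ᵐ x, |W x| ≤ B) {T : ℝ} {ω : ℝ → ℝ} (hω : Measurable ω)
    (hB : ∀ R, ∃ B, ∀ t, |t| ≤ R → |ω t| ≤ B)
    (hle : ∀ x, T ≤ log (sqnorm x) / 2 → radialPotential ω x ≤ W x)
    (hφ : ∀ k, ContDiff ℝ (⊤ : ℕ∞) (φ k)) (hα1 : ∀ k, 1 ≤ α k) (hαT : ∀ k, T ≤ α k)
    (h0 : ∀ k, ∀ t ∉ Ioo (α k) (β k), φ k t = 0 ∧ deriv (φ k) t = 0)
    (hdis : ∀ k l, k ≠ l → n k = n l → Disjoint (Ioo (α k) (β k)) (Ioo (α l) (β l)))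
    (hneg : ∀ k, (∫ t, deriv (φ k) t ^ 2) + (n k - Φ) ^ 2 * ∫ t, φ k t ^ 2 <
      ∫ t, ω t * φ k t ^ 2) :
    (Fintype.card ι : ℝ≥0∞) ≤ negEigCount Φ W := by
  have htest := isTestFun_modeSum (n := n) hφ hα1 h0
  have hlt : ∀ b : ι → ℂ, b ≠ 0 →
      magEnergy Φ (modeSum n φ b) < ∫ x, W x * ‖modeSum n φ b x‖ ^ 2 := by
    intro b hb
    obtain ⟨j, hj⟩ := Function.ne_iff.1 hb
    calc magEnergy Φ (modeSum n φ b) < 2 * π * ∑ k, ‖b k‖ ^ 2 * ∫ t, ω t * φ k t ^ 2 := by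
          rw [magEnergy_modeSum Φ hφ hα1 h0 hdis]
          refine mul_lt_mul_of_pos_left ?_ (by positivity)
          refine Finset.sum_lt_sum (fun k _ => ?_) ⟨j, Finset.mem_univ _, ?_⟩
          · exact mul_le_mul_of_nonneg_left (hneg k).le (by positivity)
          · have : 0 < ‖b j‖ := norm_pos_iff.2 hj
            exact mul_lt_mul_of_pos_left (hneg j) (by positivity)
      _ = ∫ x, radialPotential ω x * ‖modeSum n φ b x‖ ^ 2 :=
          (integral_radialPotential_modeSum hφ hα1 h0 hdis hω hB b).symm
      _ ≤ _ := by
          obtain ⟨B, hWB⟩ := hWb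
          refine integral_mono (integrable_radialPotential (htest b) hω hB)
            (integrable_mul_norm_sq (htest b) hW (hWB.mono fun x hx _ => hx)) fun x => ?_
          by_cases hx : modeSum n φ b x = 0
          · simp [hx]
          · refine mul_le_mul_of_nonneg_right (hle x ?_) (by positivity)
            obtain ⟨q, rfl⟩ := exists_logPolar_eq ((htest b).ne_zero_of_apply_ne_zero hx)
            rw [modeSum_logPolar] at hx
            obtain ⟨k, -, hk⟩ := Finset.exists_ne_zero_of_sum_ne_zero hx
            have hq : q.1 ∈ Ioo (α k) (β k) := by
              by_contra hcon
              exact hk (by rw [(h0 k _ hcon).1]; simp)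
            rw [sqnorm_logPolar, log_exp]
            linarith [hq.1, hαT k]
  have hinj : Function.Injective (modeSum n φ) := by
    rw [← LinearMap.ker_eq_bot, LinearMap.ker_eq_bot']
    intro b hb
    by_contra hne
    have := hlt b hne
    rw [hb] at this
    simp [magEnergy] at this
  have hfin : Module.finrank ℂ (LinearMap.range (modeSum n φ)) = Fintype.card ι := by
    rw [LinearMap.finrank_range_of_inj hinj, Module.finrank_fintype_fun_eq_card]
  rw [← hfin]
  refine le_iSup₂_of_le (LinearMap.range (modeSum n φ)) ⟨inferInstance, ?_, ?_⟩ le_rfl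
  · rintro _ ⟨b, rfl⟩
    exact htest b
  · rintro _ ⟨b, rfl⟩ hne
    exact hlt b fun h => hne (by rw [h, map_zero])

end ModeSum

/-- The radial minorant used for the lower bound. -/
noncomputable def radialMinorant (p σ T t : ℝ) : ℝ :=
  if t < T then 0 else σ⁻¹ * t ^ (-1 / p)

lemma measurable_radialMinorant (p σ T : ℝ) : Measurable (radialMinorant p σ T) := by
  unfold radialMinorant
  refine Measurable.ite measurableSet_Iio ?_ ?_ <;> fun_prop

lemma abs_radialMinorant_le {p σ T : ℝ} (hp : 0 < p) (hσ : 0 < σ) (hT : 1 ≤ T) (t : ℝ) :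
    |radialMinorant p σ T t| ≤ σ⁻¹ := by
  unfold radialMinorant
  split_ifs with h
  · rw [abs_zero]
    positivity
  · have ht : 0 ≤ t := by linarith
    have h1 : t ^ (-1 / p) ≤ 1 := rpow_le_one_of_one_le_of_nonpos (by linarith)
      (by rw [neg_div]; have := one_div_pos.2 hp; linarith)
    rw [abs_of_nonneg (by positivity)]
    exact mul_le_of_le_one_right (by positivity) h1

lemma radialPotential_radialMinorant_le {p σ T lam : ℝ} {V : ℝ × ℝ → ℝ} (hlam : 0 < lam)
    {x : ℝ × ℝ} (hx : T ≤ log (sqnorm x) / 2)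
    (hV : σ⁻¹ * (log (sqnorm x) / 2) ^ (-1 / p) / sqnorm x ≤ V x) :
    radialPotential (fun t => lam * radialMinorant p σ T t) x ≤ lam * V x := by
  rw [radialPotential, mul_div_assoc, radialMinorant, if_neg (not_lt.2 hx)]
  gcongr

/-- The trial functions on a single interval of the grid. -/
lemma exists_trial_family {σ A w α ℓ : ℝ} (hσ : 1 < σ) (hℓ : 0 < ℓ) {m : ℕ}
    (hm : (m : ℝ) ≤ ℓ * √((w - A) / σ) / π) (i : Fin m) :
    ∃ φ : ℝ → ℝ, ContDiff ℝ (⊤ : ℕ∞) φ ∧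
      (∀ t ∉ Ioo (α + i * (ℓ / m)) (α + (i + 1) * (ℓ / m)), φ t = 0 ∧ deriv φ t = 0) ∧
      (∫ t, deriv φ t ^ 2) + A * ∫ t, φ t ^ 2 < w * ∫ t, φ t ^ 2 := by
  have hm0 : (0 : ℝ) < m := by exact_mod_cast i.pos
  have hσ0 : 0 < σ := by linarith
  set κ := √((w - A) / σ) with hκ
  have hκ1 : m * π ≤ ℓ * κ := (le_div_iff₀ pi_pos).1 hm
  have hκ0 : 0 < κ := by
    have : 0 < ℓ * κ := lt_of_lt_of_le (by positivity) hκ1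
    exact pos_of_mul_pos_right this hℓ.le
  have hκ2 : σ * κ ^ 2 = w - A := by
    rw [hκ, sq_sqrt (sqrt_pos.1 hκ0).le]
    field_simp
  have hlen : α + (i + 1) * (ℓ / m) - (α + i * (ℓ / m)) = ℓ / m := by ring
  have hlen0 : 0 < ℓ / m := by positivity
  refine exists_trial_function hσ (by linarith) ?_
  rw [hlen, ← hκ2, mul_assoc, ← mul_pow, mul_comm]
  have : π ≤ κ * (ℓ / m) := by
    rw [mul_div_assoc', le_div_iff₀ hm0]
    linarith
  gcongr

/-- The trial functions for a single angular channel. -/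
lemma exists_channel_family {p σ T lam d a : ℝ} (hp : 1 < p) (hσ : 1 < σ) (hT : 1 ≤ T)
    (hd : 0 < d) (ha : d ≤ |a|) (hlam : 1 ≤ lam) (hlamd : 1 / d ^ 2 ≤ lam)
    {J : ℕ} (hJ : 2 * p * log lam ≤ J * log σ) :
    ∃ (ι : Type) (_ : Fintype ι) (φ : ι → ℝ → ℝ) (α β : ι → ℝ),
      Gamma (p - 1 / 2) / (2 * √π * Gamma p) * σ ^ (-(p + 3 / 2)) * lam ^ p * |a| ^ (1 - 2 * p) -
          (√lam * (∫ t in (0 : ℝ)..T, √(t ^ (-1 / p))) + J) ≤ Fintype.card ι ∧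
      (∀ k, ContDiff ℝ (⊤ : ℕ∞) (φ k)) ∧ (∀ k, T ≤ α k) ∧
      (∀ k, ∀ t ∉ Ioo (α k) (β k), φ k t = 0 ∧ deriv (φ k) t = 0) ∧
      (∀ k l, k ≠ l → Disjoint (Ioo (α k) (β k)) (Ioo (α l) (β l))) ∧
      ∀ k, (∫ t, deriv (φ k) t ^ 2) + a ^ 2 * ∫ t, φ k t ^ 2 <
        ∫ t, lam * radialMinorant p σ T t * φ k t ^ 2 := by
  have hp0 : 0 < p := by linarith
  have hσ0 : 0 < σ := by linarith
  have hlam0 : 0 < lam := by linarith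
  have hT0 : 0 < T := by linarith
  have ha0 : 0 < |a| := hd.trans_le ha
  have hda : d ^ 2 ≤ |a| ^ 2 := by gcongr
  have hneg : -1 / p ≤ 0 := by rw [neg_div]; have := one_div_pos.2 hp0; linarith
  set g : ℕ → ℝ := fun j => T * σ ^ j with hg
  have hgT : ∀ j, T ≤ g j := fun j => le_mul_of_one_le_right hT0.le (one_le_pow₀ hσ.le)
  have hgs : StrictMono g := by
    refine strictMono_nat_of_lt_succ fun j => ?_
    simp only [hg, pow_succ]
    have : 0 < σ ^ j := by positivity
    nlinarith [mul_pos hT0 this]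
  set ℓ : ℕ → ℝ := fun j => g (j + 1) - g j with hℓ
  have hℓ0 : ∀ j, 0 < ℓ j := fun j => sub_pos.2 (hgs j.lt_succ_self)
  set w : ℕ → ℝ := fun j => lam * σ⁻¹ * g (j + 1) ^ (-1 / p) with hw
  set m : ℕ → ℕ := fun j => ⌊ℓ j * √((w j - a ^ 2) / σ) / π⌋₊ with hm
  have hmle : ∀ j, (m j : ℝ) ≤ ℓ j * √((w j - a ^ 2) / σ) / π := fun j =>
    Nat.floor_le (by have := hℓ0 j; positivity)
  choose φ hφ h0 hφneg using fun (j : ℕ) (i : Fin (m j)) =>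
    exists_trial_family (α := g j) hσ (hℓ0 j) (hmle j) i
  have hα : ∀ (j : ℕ) (i : Fin (m j)), g j ≤ g j + i * (ℓ j / m j) := fun j i => by
    have := hℓ0 j
    exact le_add_of_nonneg_right (by positivity)
  have hβ : ∀ (j : ℕ) (i : Fin (m j)), g j + (i + 1) * (ℓ j / m j) ≤ g (j + 1) := fun j i => by
    have h1 : (0 : ℝ) < m j := by exact_mod_cast i.pos
    have h2 : (i : ℝ) + 1 ≤ m j := by exact_mod_cast i.2
    have h3 := hℓ0 j
    have h4 : ((i : ℝ) + 1) * (ℓ j / m j) ≤ m j * (ℓ j / m j) := by gcongr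
    have h5 : m j * (ℓ j / m j) = g (j + 1) - g j := by field_simp; rfl
    linarith
  refine ⟨Σ j : Fin J, Fin (m j), inferInstance, fun k => φ k.1 k.2,
    fun k => g k.1 + k.2 * (ℓ k.1 / m k.1), fun k => g k.1 + (k.2 + 1) * (ℓ k.1 / m k.1),
    ?_, fun k => hφ _ _, fun k => (hgT _).trans (hα _ _), fun k => h0 _ _, ?_, fun k => ?_⟩
  · rw [Fintype.card_sigma]
    simp only [Fintype.card_fin]
    rw [Fin.sum_univ_eq_sum_range (fun j => m j) J, Nat.cast_sum]
    have h1 : ∑ j ∈ Finset.range J, (ℓ j * √((w j - a ^ 2) / σ) / π - 1) ≤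
        ∑ j ∈ Finset.range J, (m j : ℝ) :=
      Finset.sum_le_sum fun j _ => (Nat.sub_one_lt_floor _).le
    refine le_trans ?_ h1
    have hJσ : (lam * σ⁻¹ * σ ^ (-1 / p) / |a| ^ 2) ^ p ≤ T * σ ^ J := by
      have h2 : lam * σ⁻¹ * σ ^ (-1 / p) / |a| ^ 2 ≤ lam ^ (2 : ℝ) := by
        have e1 : σ ^ (-1 / p) ≤ 1 := rpow_le_one_of_one_le_of_nonpos hσ.le hneg
        have e2 : σ⁻¹ ≤ 1 := inv_le_one_of_one_le₀ hσ.le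
        calc lam * σ⁻¹ * σ ^ (-1 / p) / |a| ^ 2 ≤ lam * 1 * 1 / d ^ 2 := by gcongr
          _ = lam * (1 / d ^ 2) := by ring
          _ ≤ lam * lam := by gcongr
          _ = lam ^ (2 : ℝ) := by rw [rpow_two, sq]
      have h3 : lam ^ (2 * p) ≤ σ ^ J := by
        rw [← rpow_natCast, rpow_def_of_pos hlam0, rpow_def_of_pos hσ0]
        apply exp_le_exp.2
        linarith
      calc (lam * σ⁻¹ * σ ^ (-1 / p) / |a| ^ 2) ^ p ≤ (lam ^ (2 : ℝ)) ^ p := by gcongr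
        _ = lam ^ (2 * p) := by rw [rpow_mul hlam0.le]
        _ ≤ σ ^ J := h3
        _ ≤ T * σ ^ J := le_mul_of_one_le_left (by positivity) hT
    have h2 := integral_le_sum_grid (Λ := lam * σ⁻¹) hp (by positivity) ha0 hσ hT0 hJσ
    have h3 := integral_sqrt_mul_rpow_sub_sq (Λ := lam * σ⁻¹ * σ ^ (-1 / p)) hp
      (by positivity) ha0
    rw [h3] at h2
    set I := ∫ t in (0 : ℝ)..T, √(t ^ (-1 / p)) with hI
    have hI0 : 0 ≤ I := intervalIntegral.integral_nonneg hT0.le fun t _ => sqrt_nonneg _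
    rw [Finset.sum_sub_distrib, Finset.sum_const, Finset.card_range, nsmul_eq_mul, mul_one]
    have h4 : ∑ j ∈ Finset.range J, ℓ j * √((w j - a ^ 2) / σ) / π = (√σ)⁻¹ / π *
        ∑ j ∈ Finset.range J, (T * σ ^ (j + 1) - T * σ ^ j) *
          √(lam * σ⁻¹ * (T * σ ^ (j + 1)) ^ (-1 / p) - |a| ^ 2) := by
      rw [Finset.mul_sum]
      refine Finset.sum_congr rfl fun j _ => ?_
      rw [sqrt_div' _ hσ0.le, sq_abs]
      simp only [hℓ, hg, hw]
      ring
    rw [h4]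
    have h5 : (√σ)⁻¹ / π ≤ 1 := by
      have e1 : (√σ)⁻¹ ≤ 1 := inv_le_one_of_one_le₀ (one_le_sqrt.2 hσ.le)
      rw [div_le_one pi_pos]
      linarith [pi_gt_three]
    have h6 : (√σ)⁻¹ / π * (√(lam * σ⁻¹) * I) ≤ √lam * I := by
      have e1 : √(lam * σ⁻¹) ≤ √lam :=
        sqrt_le_sqrt (mul_le_of_le_one_right hlam0.le (inv_le_one_of_one_le₀ hσ.le))
      calc (√σ)⁻¹ / π * (√(lam * σ⁻¹) * I) ≤ 1 * (√lam * I) := by gcongr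
        _ = _ := one_mul _
    have h7 : (√σ)⁻¹ / π * (π * (Gamma (p - 1 / 2) / (2 * √π * Gamma p)) *
        ((lam * σ⁻¹ * σ ^ (-1 / p)) ^ p * |a| ^ (1 - 2 * p))) =
        Gamma (p - 1 / 2) / (2 * √π * Gamma p) * σ ^ (-(p + 3 / 2)) * lam ^ p *
          |a| ^ (1 - 2 * p) := by
      have e1 : σ ^ (-(p + 3 / 2)) = (√σ)⁻¹ * ((σ ^ p)⁻¹ * σ⁻¹) := by
        rw [sqrt_eq_rpow, ← rpow_neg hσ0.le, ← rpow_neg hσ0.le, ← rpow_neg_one, ← rpow_add hσ0,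
          ← rpow_add hσ0]
        congr 1
        ring
      rw [mul_rpow (by positivity) (by positivity), mul_rpow hlam0.le (by positivity),
        ← rpow_mul hσ0.le, show -1 / p * p = -1 by field_simp, inv_rpow hσ0.le, rpow_neg_one, e1]
      generalize Gamma (p - 1 / 2) / (2 * √π * Gamma p) = c
      field_simp
    have h8 : 0 ≤ (√σ)⁻¹ / π := by positivity
    have h9 := mul_le_mul_of_nonneg_left h2 h8
    rw [mul_sub, h7] at h9
    linarith
  · rintro ⟨j, i⟩ ⟨j', i'⟩ hne
    rw [Ioo_disjoint_Ioo]
    dsimp only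
    rcases lt_trichotomy j j' with h | h | h
    · exact (min_le_left _ _).trans (le_trans ((hβ j i).trans ((hgs.monotone
        (show (j : ℕ) + 1 ≤ j' from h)).trans (hα j' i'))) (le_max_right _ _))
    · subst h
      have hl : 0 ≤ ℓ j / m j := by have := hℓ0 j; positivity
      have hii : i ≠ i' := fun e => hne (by rw [e])
      rcases lt_or_gt_of_ne hii with h | h
      · have h1 : (i : ℝ) + 1 ≤ i' := by exact_mod_cast h
        refine (min_le_left _ _).trans (le_trans ?_ (le_max_right _ _))
        gcongr
      · have h1 : (i' : ℝ) + 1 ≤ i := by exact_mod_cast h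
        refine (min_le_right _ _).trans (le_trans ?_ (le_max_left _ _))
        gcongr
    · exact (min_le_right _ _).trans (le_trans ((hβ j' i').trans ((hgs.monotone
        (show (j' : ℕ) + 1 ≤ j from h)).trans (hα j i))) (le_max_left _ _))
  · obtain ⟨j, i⟩ := k
    dsimp only
    refine (hφneg j i).trans_le ?_
    have hz : ∀ t, g (j + 1) < |t| → φ j i t ^ 2 = 0 := by
      intro t ht
      rw [(h0 j i t ?_).1, zero_pow two_ne_zero]
      rintro ⟨h1, h2⟩
      have h3 := hα j i
      have h4 := hβ j i
      have h5 := hgT j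
      rw [abs_of_pos (by linarith)] at ht
      linarith
    have hc : Continuous fun t => φ j i t ^ 2 := (hφ j i).continuous.pow 2
    have hi1 : Integrable fun t => w j * φ j i t ^ 2 :=
      integrable_mul_of_eq_zero measurable_const (fun R => ⟨|w j|, fun _ _ => le_rfl⟩) hc hz
    have hi2 : Integrable fun t => lam * radialMinorant p σ T t * φ j i t ^ 2 :=
      integrable_mul_of_eq_zero ((measurable_radialMinorant p σ T).const_mul lam)
        (fun R => ⟨lam * σ⁻¹, fun t _ => by
          rw [abs_mul, abs_of_pos hlam0]
          have := abs_radialMinorant_le hp0 hσ0 hT t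
          gcongr⟩) hc hz
    rw [← integral_const_mul]
    refine integral_mono hi1 hi2 fun t => ?_
    dsimp only
    by_cases ht : t ∈ Ioo (g j + i * (ℓ j / m j)) (g j + (i + 1) * (ℓ j / m j))
    · refine mul_le_mul_of_nonneg_right ?_ (sq_nonneg _)
      have h1 : T ≤ t := (hgT j).trans ((hα j i).trans ht.1.le)
      have h2 : t ≤ g (j + 1) := ht.2.le.trans (hβ j i)
      have h3 : g (j + 1) ^ (-1 / p) ≤ t ^ (-1 / p) :=
        rpow_le_rpow_of_nonpos (by linarith) h2 hneg
      rw [radialMinorant, if_neg (not_lt.2 h1), ← mul_assoc]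
      simp only [hw]
      gcongr
    · rw [(h0 j i t ht).1]
      simp

/-- Lower bound for the number of negative eigenvalues. -/
lemma exists_le_negEigCount {Φ : ℝ} (hΦ : ∀ k : ℤ, Φ ≠ k) {p : ℝ} (hp : 1 < p)
    {V : ℝ × ℝ → ℝ} (hVmeas : Measurable V) (hVbdd : ∃ B : ℝ, ∀ᵐ x : ℝ × ℝ, |V x| ≤ B)
    (hVasymp : Filter.Tendsto
      (fun x : ℝ × ℝ => sqnorm x * Real.log (Real.sqrt (sqnorm x)) ^ (1 / p) * V x)
      (Filter.cocompact (ℝ × ℝ)) (nhds 1)) {σ : ℝ} (hσ : 1 < σ) (F : Finset ℤ) :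
    ∃ C : ℝ, ∀ᶠ lam : ℝ in Filter.atTop,
      ENNReal.ofReal (σ ^ (-(p + 3 / 2)) * lam ^ p * (Gamma (p - 1 / 2) / (2 * √π * Gamma p) *
        ∑ n ∈ F, |(n : ℝ) - Φ| ^ (1 - 2 * p)) + C * (lam * (1 + log lam))) ≤
      negEigCount Φ (fun x => lam * V x) := by
  have hp0 : 0 < p := by linarith
  have hσ0 : 0 < σ := by linarith
  obtain ⟨B, hB⟩ := hVbdd
  obtain ⟨T, hT, hTV⟩ := exists_radial_bounds hVasymp hσ
  obtain ⟨d, hd, hdn⟩ := exists_pos_le_abs_int_sub hΦ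
  have hlogσ : 0 < log σ := log_pos hσ
  set c := Gamma (p - 1 / 2) / (2 * √π * Gamma p) with hc
  set K := 2 * p / log σ with hK
  have hK0 : 0 < K := by positivity
  set I := ∫ t in (0 : ℝ)..T, √(t ^ (-1 / p)) with hI
  have hI0 : 0 ≤ I := intervalIntegral.integral_nonneg (by linarith) fun t _ => sqrt_nonneg _
  refine ⟨-(F.card * (I + K + 1)), ?_⟩
  filter_upwards [Filter.eventually_ge_atTop 1, Filter.eventually_ge_atTop (1 / d ^ 2)]
    with lam h1 h2
  have hlam0 : 0 < lam := by linarith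
  have hl : 0 ≤ log lam := log_nonneg h1
  set J : ℕ := ⌈K * log lam⌉₊ with hJ
  have hJ1 : K * log lam ≤ J := Nat.le_ceil _
  have hJ2 : (J : ℝ) ≤ K * log lam + 1 := (Nat.ceil_lt_add_one (by positivity)).le
  have hJσ : 2 * p * log lam ≤ J * log σ := by
    have h4 : K * log lam * log σ ≤ J * log σ := by gcongr
    have h5 : K * log lam * log σ = 2 * p * log lam := by rw [hK]; field_simp
    linarith
  choose ι hι φ α β hcard hφ hα h0 hdis hneg using fun n : ℤ =>
    exists_channel_family (a := (n : ℝ) - Φ) hp hσ hT hd (hdn n) h1 h2 hJσ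
  have key := card_le_negEigCount (ι := Σ n : F, ι n) (n := fun k => (k.1 : ℤ))
    (φ := fun k => φ k.1 k.2) (α := fun k => α k.1 k.2) (β := fun k => β k.1 k.2) Φ
    (W := fun x => lam * V x) (hVmeas.const_mul lam)
    ⟨lam * B, hB.mono fun x hx => by rw [abs_mul, abs_of_pos hlam0]; gcongr⟩ (T := T)
    ((measurable_radialMinorant p σ T).const_mul lam)
    (fun R => ⟨lam * σ⁻¹, fun t _ => by
      rw [abs_mul, abs_of_pos hlam0]
      have := abs_radialMinorant_le hp0 hσ0 hT t
      gcongr⟩)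
    (fun x hx => radialPotential_radialMinorant_le hlam0 hx (hTV x hx).2)
    (fun k => hφ _ _) (fun k => hT.trans (hα _ _)) (fun k => hα _ _) (fun k => h0 _ _) ?_
    (fun k => hneg _ _)
  · refine le_trans ?_ key
    rw [← ENNReal.ofReal_natCast]
    apply ENNReal.ofReal_le_ofReal
    rw [Fintype.card_sigma, Finset.sum_coe_sort F (fun n => Fintype.card (ι n))]
    push_cast
    have hE : √lam * I + J ≤ (I + K + 1) * (lam * (1 + log lam)) := by
      have e1 : √lam ≤ lam := sqrt_le_iff.2 ⟨hlam0.le, by nlinarith⟩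
      have e2 : lam ≤ lam * (1 + log lam) := le_mul_of_one_le_right hlam0.le (by linarith)
      have e3 : log lam ≤ lam * (1 + log lam) := by nlinarith
      calc √lam * I + J ≤ lam * (1 + log lam) * I + (K * (lam * (1 + log lam)) + 1) := by
            refine add_le_add (by gcongr; linarith) (hJ2.trans ?_)
            gcongr
        _ ≤ _ := by linarith
    calc σ ^ (-(p + 3 / 2)) * lam ^ p * (c * ∑ n ∈ F, |(n : ℝ) - Φ| ^ (1 - 2 * p)) +
          -(F.card * (I + K + 1)) * (lam * (1 + log lam))
        = ∑ n ∈ F, (c * σ ^ (-(p + 3 / 2)) * lam ^ p * |(n : ℝ) - Φ| ^ (1 - 2 * p) -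
          (I + K + 1) * (lam * (1 + log lam))) := by
          rw [Finset.sum_sub_distrib, ← Finset.mul_sum, Finset.sum_const, nsmul_eq_mul]
          ring
      _ ≤ _ := Finset.sum_le_sum fun n _ => le_trans (by linarith) (hcard n)
  · rintro ⟨n, k⟩ ⟨n', k'⟩ hne hn
    obtain rfl : n = n' := Subtype.ext hn
    exact hdis n k k' fun e => hne (by rw [e])

/-- The error terms are of lower order. -/
lemma tendsto_rpow_neg_mul {p : ℝ} (hp : 1 < p) (D C : ℝ) :
    Filter.Tendsto (fun lam : ℝ => lam ^ (-p) * (lam ^ p * D + C * (lam * (1 + log lam))))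
      Filter.atTop (nhds D) := by
  have hp1 : 0 < p - 1 := by linarith
  have h1 : Filter.Tendsto (fun lam : ℝ => log lam * lam ^ (-(p - 1))) Filter.atTop (nhds 0) := by
    refine (isLittleO_log_rpow_atTop hp1).tendsto_div_nhds_zero.congr' ?_
    filter_upwards [Filter.eventually_gt_atTop 0] with lam h
    rw [rpow_neg h.le, div_eq_mul_inv]
  have h2 := tendsto_rpow_neg_atTop hp1
  have h3 := ((h2.add h1).const_mul C).const_add D
  rw [add_zero, mul_zero, add_zero] at h3
  refine h3.congr' ?_
  filter_upwards [Filter.eventually_gt_atTop 0] with lam h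
  have e1 : lam ^ (-p) * lam ^ p = 1 := by rw [← rpow_add h, neg_add_cancel, rpow_zero]
  have e2 : lam ^ (-(p - 1)) = lam ^ (-p) * lam := by
    rw [← rpow_add_one h.ne']
    congr 1
    ring
  rw [e2]
  linear_combination (-D) * e1

theorem strong_coupling_asymptotics_AB_long_range
    (Φ : ℝ) (hΦ : ∀ k : ℤ, Φ ≠ k) (p : ℝ) (hp : 1 < p)
    (V : ℝ × ℝ → ℝ) (hVmeas : Measurable V)
    (hVbdd : ∃ B : ℝ, ∀ᵐ x : ℝ × ℝ, |V x| ≤ B)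
    (hVasymp : Filter.Tendsto
      (fun x : ℝ × ℝ => sqnorm x * Real.log (Real.sqrt (sqnorm x)) ^ (1 / p) * V x)
      (Filter.cocompact (ℝ × ℝ)) (nhds 1)) :
    Filter.Tendsto
      (fun lam : ℝ => ENNReal.ofReal (lam ^ (-p)) * negEigCount Φ (fun x => lam * V x))
      Filter.atTop
      (nhds (ENNReal.ofReal
        (Real.Gamma (p - 1 / 2) / (2 * Real.sqrt Real.pi * Real.Gamma p) *
          ∑' n : ℤ, |(n : ℝ) - Φ| ^ (1 - 2 * p)))) := by
  have hcont : ∀ r D : ℝ, Filter.Tendsto (fun σ : ℝ => ENNReal.ofReal (σ ^ r * D))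
      (nhdsWithin 1 (Ioi 1)) (nhds (ENNReal.ofReal D)) := by
    intro r D
    refine (ENNReal.continuous_ofReal.tendsto D).comp ?_
    have h := ((continuousAt_rpow_const 1 r (Or.inl one_ne_zero)).mul_const D).tendsto
    rw [one_rpow, one_mul] at h
    exact h.mono_left nhdsWithin_le_nhds
  have hlim : ∀ D C : ℝ, Filter.Tendsto (fun lam : ℝ => ENNReal.ofReal (lam ^ (-p)) *
      ENNReal.ofReal (lam ^ p * D + C * (lam * (1 + log lam)))) Filter.atTop
      (nhds (ENNReal.ofReal D)) := by
    intro D C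
    refine ((ENNReal.continuous_ofReal.tendsto D).comp (tendsto_rpow_neg_mul hp D C)).congr' ?_
    filter_upwards [Filter.eventually_ge_atTop 0] with lam h
    exact ENNReal.ofReal_mul (rpow_nonneg h _)
  refine tendsto_order.2 ⟨fun y hy => ?_, fun y hy => ?_⟩
  · have hF := (ENNReal.continuous_ofReal.tendsto _).comp
      ((summable_abs_int_sub_rpow Φ hp).hasSum.mul_left
        (Gamma (p - 1 / 2) / (2 * √π * Gamma p)))
    obtain ⟨F, hF⟩ := (hF.eventually (lt_mem_nhds hy)).exists
    simp only [Function.comp_apply, ← Finset.mul_sum] at hF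
    obtain ⟨σ, hσy, hσ⟩ := (((hcont (-(p + 3 / 2)) _).eventually (lt_mem_nhds hF)).and
      self_mem_nhdsWithin).exists
    obtain ⟨C, hC⟩ := exists_le_negEigCount hΦ hp hVmeas hVbdd hVasymp hσ F
    filter_upwards [hC, (hlim _ C).eventually (lt_mem_nhds hσy)] with lam h1 h2
    refine h2.trans_le (mul_le_mul_right (le_trans (le_of_eq ?_) h1) _)
    congr 1
    ring
  · obtain ⟨σ, hσy, hσ⟩ := (((hcont (p + 1) _).eventually (gt_mem_nhds hy)).and
      self_mem_nhdsWithin).exists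
    obtain ⟨C, hC⟩ := exists_negEigCount_le hΦ hp hVmeas hVbdd hVasymp hσ
    filter_upwards [hC, (hlim _ C).eventually (gt_mem_nhds hσy)] with lam h1 h2
    refine lt_of_le_of_lt (mul_le_mul_right (h1.trans (le_of_eq ?_)) _) h2
    congr 1
    ring
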